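/- Let G be a finitely generated group, E an admissible family of subgroups of G, and T a minimal E-tree with more than one cylinder in which every vertex has valence at least 3. Let Y be a cylinder with |∂Y| ≥ 4. Let S and S' be non-trivial special forests with S' ⊆ S, such that [[S]] is the non-peripheral cross-connected component C_Y based on Y and [[S']] ≠ C_Y. Then η = η_Y(S') ∈ Y is defined, η ∈ S, and S' contains an equivalent subforest S'' with S'' ⊆ pr_Y⁻¹({η}) ⊆ S. Moreover, Φ([[S']]) lies in the connected component of T_c ∖ {Y_c} containing η_c. -/

import Mathlib

open scoped Pointwise symmDiff

namespace SSRN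

section Group
variable {G : Type*} [Group G]

/-- A subset of `G` is `H`-finite if it is contained in finitely many orbits of the
action of `H` on `G` by left multiplication. -/
def HFin (H : Subgroup G) (X : Set G) : Prop :=
  ∃ F : Finset G, X ⊆ ⋃ f ∈ F, (· * f) '' (H : Set G)

/-- Two subsets of `G` are `H`-equivalent if their symmetric difference is `H`-finite. -/
def AIEquiv (H : Subgroup G) (X Y : Set G) : Prop := HFin H (X ∆ Y)

/-- `X` is an `H`-almost invariant subset of `G`. -/
def IsAI (H : Subgroup G) (X : Set G) : Prop :=
  (∀ h ∈ H, (h * ·) '' X = X) ∧ ∀ s : G, HFin H (((· * s) '' X) ∆ X)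

/-- `X` is a non-trivial `H`-almost invariant subset of `G`. -/
def NontrivAI (H : Subgroup G) (X : Set G) : Prop :=
  IsAI H X ∧ ¬ HFin H X ∧ ¬ HFin H Xᶜ

/-- The `H`-almost invariant set `X` crosses `Y`: none of the four corners is `H`-finite. -/
def Crosses (H : Subgroup G) (X Y : Set G) : Prop :=
  ¬ HFin H (X ∩ Y) ∧ ¬ HFin H (X ∩ Yᶜ) ∧ ¬ HFin H (Xᶜ ∩ Y) ∧ ¬ HFin H (Xᶜ ∩ Yᶜ)

/-- Crossing of (non-trivial) almost invariant sets, quantifying over the groups over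
which they are almost invariant. -/
def CrossesAny (X X' : Set G) : Prop :=
  ∃ H K : Subgroup G, NontrivAI H X ∧ NontrivAI K X' ∧ Crosses H X X'

/-- `X` and `X'` determine the same unordered pair `{[X], [X*]}` of equivalence classes. -/
def SamePair (X X' : Set G) : Prop :=
  ∃ H : Subgroup G, NontrivAI H X ∧ (HFin H (X ∆ X') ∨ HFin H (X ∆ X'ᶜ))

/-- An admissible family of subgroups: conjugacy invariant, closed under commensurability,
and no member contains another with infinite index. -/
def Admissible (E : Set (Subgroup G)) : Prop :=
  (∀ H ∈ E, ∀ g : G, (MulAut.conj g • H) ∈ E) ∧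
  (∀ H ∈ E, ∀ K : Subgroup G, Subgroup.Commensurable K H → K ∈ E) ∧
  (∀ A ∈ E, ∀ B ∈ E, A ≤ B → A.relIndex B ≠ 0)

end Group

section Tree

variable {V : Type*}

/-- The stabilizer of an edge `e : Sym2 V` under the action of `G`. -/
def edgeStab (G : Type*) [Group G] [MulAction G V] (e : Sym2 V) : Subgroup G where
  carrier := {g | Sym2.map (g • ·) e = e}
  one_mem' := by
    show Sym2.map ((1 : G) • ·) e = e
    have : ((1 : G) • · : V → V) = id := by funext v; simp
    rw [this, Sym2.map_id]; rfl
  mul_mem' := by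
    intro a b ha hb
    show Sym2.map ((a * b) • ·) e = e
    have : ((a * b) • · : V → V) = (a • ·) ∘ (b • ·) := by funext v; simp [mul_smul]
    rw [this, ← Sym2.map_map, hb, ha]
  inv_mem' := by
    intro a ha
    show Sym2.map (a⁻¹ • ·) e = e
    conv_lhs => rw [← ha]
    rw [Sym2.map_map]
    have : ((a⁻¹ • ·) ∘ (a • ·) : V → V) = id := by funext v; simp
    rw [this, Sym2.map_id]; rfl

variable (T : SimpleGraph V)

/-- `G` acts on the graph `T` by graph automorphisms. -/
def ActsOn (G : Type*) [Group G] [MulAction G V] : Prop :=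
  ∀ (g : G) (u v : V), T.Adj u v → T.Adj (g • u) (g • v)

/-- The action of `G` on `T` is without inversions. -/
def NoInversions (G : Type*) [Group G] [MulAction G V] : Prop :=
  ∀ (g : G) (u v : V), T.Adj u v → ¬ (g • u = v ∧ g • v = u)

/-- `w` lies between `u` and `v`: it is on every path from `u` to `v`. -/
def Btw (u w v : V) : Prop := ∀ p : T.Walk u v, p.IsPath → w ∈ p.support

/-- The action of `G` on the tree `T` is minimal: every nonempty invariant subtree
(convex invariant set of vertices) is the whole vertex set. -/
def MinimalAction (G : Type*) [Group G] [MulAction G V] : Prop :=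
  ∀ A : Set V, A.Nonempty → (∀ (g : G), ∀ a ∈ A, g • a ∈ A) →
    (∀ u ∈ A, ∀ v ∈ A, ∀ w : V, Btw T u w v → w ∈ A) → A = Set.univ

/-- The action of `G` is non-trivial: there is no global fixed vertex. -/
def NontrivialAction (G : Type*) [Group G] [MulAction G V] : Prop :=
  ¬ ∃ v : V, ∀ g : G, g • v = v

/-- `T` is an `E`-tree: all edge stabilizers belong to `E`. -/
def IsETree (G : Type*) [Group G] [MulAction G V] (E : Set (Subgroup G)) : Prop :=
  ∀ e ∈ T.edgeSet, edgeStab G e ∈ E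

/-- There are finitely many `G`-orbits of edges. -/
def FinEdgeOrbits (G : Type*) [Group G] [MulAction G V] : Prop :=
  ∃ F : Finset (Sym2 V), ∀ e ∈ T.edgeSet, ∃ e₀ ∈ F, ∃ g : G, Sym2.map (g • ·) e₀ = e

/-- A cylinder of `T`: an equivalence class of edges for commensurability of stabilizers. -/
def IsCylinder (G : Type*) [Group G] [MulAction G V] (Y : Set (Sym2 V)) : Prop :=
  Y.Nonempty ∧ Y ⊆ T.edgeSet ∧
    ∀ e ∈ Y, ∀ e' ∈ T.edgeSet,
      (e' ∈ Y ↔ Subgroup.Commensurable (edgeStab G e) (edgeStab G (V := V) e'))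

/-- The set of vertices of a set of edges (e.g. of a cylinder). -/
def cylVerts (Y : Set (Sym2 V)) : Set V := {v | ∃ e ∈ Y, v ∈ e}

/-- The boundary of a cylinder: its vertices lying in another cylinder,
i.e. incident to an edge outside the cylinder. -/
def cylBoundary (Y : Set (Sym2 V)) : Set V :=
  {v | v ∈ cylVerts Y ∧ ∃ e ∈ T.edgeSet, v ∈ e ∧ e ∉ Y}

/-- `H` belongs to the commensurability class associated to the cylinder `Y`. -/
def InClassOf (G : Type*) [Group G] [MulAction G V] (Y : Set (Sym2 V)) (H : Subgroup G) : Prop :=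
  ∃ e ∈ Y, Subgroup.Commensurable H (edgeStab G e)

/-- The coboundary of a set of vertices: edges with exactly one endpoint in it. -/
def cobdry (S : Set V) : Set (Sym2 V) :=
  {e | e ∈ T.edgeSet ∧ ∃ u v : V, e = s(u, v) ∧ u ∈ S ∧ v ∉ S}

/-- `S` is a special forest based on the cylinder `Y`. -/
def IsSpecialForest (S : Set V) (Y : Set (Sym2 V)) : Prop :=
  (cobdry T S).Finite ∧ cobdry T S ⊆ Y

/-- A set of vertices is non-trivial if it is neither finite nor cofinite. -/
def NontrivForest (S : Set V) : Prop := ¬ S.Finite ∧ ¬ (Sᶜ : Set V).Finite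

/-- The almost invariant set associated to a set of vertices. -/
def XS (G : Type*) [Group G] [MulAction G V] (v₀ : V) (S : Set V) : Set G :=
  {g : G | g • v₀ ∈ S}

/-- The component `T_e` of `T` minus the open edge `e = s(u,v)` containing the terminal
vertex `v`. -/
def halfTree (u v : V) : Set V :=
  {w | ∃ p : T.Walk v w, p.IsPath ∧ s(u, v) ∉ p.edges}

/-- The almost invariant set `Z_e` dual to the oriented edge `(u, v)`. -/
def Ze (G : Type*) [Group G] [MulAction G V] (v₀ u v : V) : Set G :=
  XS G v₀ (halfTree T u v)

/-- `v` has finitely many incident edges in `Y`. -/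
def FiniteValenceIn (Y : Set (Sym2 V)) (v : V) : Prop := {e | e ∈ Y ∧ v ∈ e}.Finite

/-- The peripheral special forest `S_{v,Y}`: the component of `v` in `T` minus the open
edges of `Y` incident to `v`. -/
def periForest (Y : Set (Sym2 V)) (v : V) : Set V :=
  {w | ∃ p : T.Walk v w, p.IsPath ∧ ∀ e ∈ Y, v ∈ e → e ∉ p.edges}

/-- The peripheral almost invariant set `X_{v,Y}`. -/
def XvY (G : Type*) [Group G] [MulAction G V] (v₀ : V) (Y : Set (Sym2 V)) (v : V) : Set G :=
  XS G v₀ (periForest T Y v)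

/-- A peripheral special forest: one equivalent to some `S_{v,Y}`. -/
def PeripheralForest (G : Type*) [Group G] [MulAction G V] (S : Set V) : Prop :=
  ∃ (Y : Set (Sym2 V)) (v : V), IsCylinder T G Y ∧ v ∈ cylBoundary T Y ∧
    FiniteValenceIn Y v ∧ (S ∆ periForest T Y v).Finite

/-- The Boolean algebra `B_C(T)` of (representatives of) almost invariant sets based on the
cylinder `Y`: the smallest family containing the sets `Z_e`, `e ∈ Y`, closed under
complement, intersection and `H`-equivalence. -/
def BCT {G : Type*} [Group G] [MulAction G V] (v₀ : V) (Y : Set (Sym2 V)) (H : Subgroup G) :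
    Set (Set G) :=
  ⋂₀ {F : Set (Set G) |
    (∀ u v : V, T.Adj u v → s(u, v) ∈ Y → Ze T G v₀ u v ∈ F) ∧
    (∀ X ∈ F, Xᶜ ∈ F) ∧
    (∀ X ∈ F, ∀ X' ∈ F, X ∩ X' ∈ F) ∧
    (∀ X ∈ F, ∀ X' : Set G, HFin H (X ∆ X') → X' ∈ F)}

/-- The set `B(T)` of (representatives of) almost invariant sets based on `T`. -/
def BT (G : Type*) [Group G] [MulAction G V] (v₀ : V) : Set (Set G) :=
  {X | ∃ Y : Set (Sym2 V), IsCylinder T G Y ∧ ∃ e ∈ Y, X ∈ BCT T v₀ Y (edgeStab G e)}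

/-- Elements of `B(T)` that are non-trivial almost invariant sets. -/
def NontrivB (G : Type*) [Group G] [MulAction G V] (v₀ : V) : Set (Set G) :=
  {X | X ∈ BT T G v₀ ∧ ∃ H : Subgroup G, NontrivAI H X}

/-- One step of the relation generating cross-connected components. -/
def ccStep (G : Type*) [Group G] [MulAction G V] (v₀ : V) (X X' : Set G) : Prop :=
  X ∈ NontrivB T G v₀ ∧ X' ∈ NontrivB T G v₀ ∧ (CrossesAny X X' ∨ SamePair X X')

/-- The equivalence relation generated by crossing (and identification of equivalent sets
and complements) on `B(T)`. -/
def ccRel (G : Type*) [Group G] [MulAction G V] (v₀ : V) : Set G → Set G → Prop :=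
  Relation.EqvGen (ccStep T G v₀)

/-- The cross-connected component of (the pair determined by) `X`. -/
def ccOf (G : Type*) [Group G] [MulAction G V] (v₀ : V) (X : Set G) : Set (Set G) :=
  {X' | ccRel T G v₀ X X'}

/-- `C` is a cross-connected component of `B(T)`. -/
def IsCCC (G : Type*) [Group G] [MulAction G V] (v₀ : V) (C : Set (Set G)) : Prop :=
  ∃ X ∈ NontrivB T G v₀, C = ccOf T G v₀ X

/-- A cross-connected component is based on the cylinder `Y` if its members are almost
invariant over subgroups in the commensurability class of `Y`. -/
def CCCBasedOn (G : Type*) [Group G] [MulAction G V] (Y : Set (Sym2 V)) (C : Set (Set G)) :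
    Prop :=
  ∃ X ∈ C, ∃ H : Subgroup G, InClassOf G Y H ∧ NontrivAI H X

/-- A peripheral cross-connected component. -/
def PeripheralCCC (G : Type*) [Group G] [MulAction G V] (v₀ : V) (C : Set (Set G)) : Prop :=
  ∃ (Y : Set (Sym2 V)) (v : V), IsCylinder T G Y ∧ v ∈ cylBoundary T Y ∧
    FiniteValenceIn Y v ∧ XvY T G v₀ Y v ∈ C

/-- Betweenness of (distinct) cross-connected components. -/
def CCCBetween {G : Type*} [Group G] (C₁ C₂ C₃ : Set (Set G)) : Prop :=
  C₁ ≠ C₂ ∧ C₂ ≠ C₃ ∧ C₁ ≠ C₃ ∧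
    ∃ X₁ ∈ C₁, ∃ X₂ ∈ C₂, ∃ X₃ ∈ C₃, X₁ ⊆ X₂ ∧ X₂ ⊆ X₃

/-- A star of cross-connected components. -/
def IsStar (G : Type*) [Group G] [MulAction G V] (v₀ : V) (St : Set (Set (Set G))) : Prop :=
  (∀ C ∈ St, IsCCC T G v₀ C) ∧ St.Nontrivial ∧
  (∀ C ∈ St, ∀ C' ∈ St, ∀ C'' : Set (Set G), IsCCC T G v₀ C'' → ¬ CCCBetween C C'' C') ∧
  (∀ St' : Set (Set (Set G)), St ⊆ St' → (∀ C ∈ St', IsCCC T G v₀ C) →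
    (∀ C ∈ St', ∀ C' ∈ St', ∀ C'' : Set (Set G), IsCCC T G v₀ C'' → ¬ CCCBetween C C'' C') →
    St' = St)

/-- The regular neighbourhood `RN(B(T))`: the bipartite graph on cross-connected
components and stars. -/
def RNGraph (G : Type*) [Group G] [MulAction G V] (v₀ : V) :
    SimpleGraph ({C : Set (Set G) // IsCCC T G v₀ C} ⊕
      {St : Set (Set (Set G)) // IsStar T G v₀ St}) where
  Adj x y :=
    match x, y with
    | Sum.inl C, Sum.inr St => C.1 ∈ St.1
    | Sum.inr St, Sum.inl C => C.1 ∈ St.1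
    | _, _ => False
  symm := by constructor; rintro (C | St) (C' | St') h <;> exact h
  loopless := by constructor; rintro (C | St) h <;> exact h

/-- Vertices of `T` lying in at least two cylinders. -/
def TcV0 (G : Type*) [Group G] [MulAction G V] : Set V :=
  {v | ∃ Y Y' : Set (Sym2 V), IsCylinder T G Y ∧ IsCylinder T G Y' ∧ Y ≠ Y' ∧
    v ∈ cylVerts Y ∧ v ∈ cylVerts Y'}

/-- The tree of cylinders `T_c` of `T`, as a bipartite graph. -/
def TcGraph (G : Type*) [Group G] [MulAction G V] :
    SimpleGraph ({v : V // v ∈ TcV0 T G} ⊕ {Y : Set (Sym2 V) // IsCylinder T G Y}) where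
  Adj x y :=
    match x, y with
    | Sum.inl v, Sum.inr Y => v.1 ∈ cylVerts Y.1
    | Sum.inr Y, Sum.inl v => v.1 ∈ cylVerts Y.1
    | _, _ => False
  symm := by constructor; rintro (v | Y) (v' | Y') h <;> exact h
  loopless := by constructor; rintro (v | Y) h <;> exact h


/-- `T` dominates `T'`: there is a `G`-equivariant map. -/
def Dominates (G : Type*) [Group G] {V V' : Type*} [MulAction G V] [MulAction G V']
    (T : SimpleGraph V) (T' : SimpleGraph V') : Prop :=
  ∃ f : V → V', ∀ (g : G) (x : V), f (g • x) = g • f x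

end Tree

section Subdiv

variable {α β : Type*}

/-- `S` is a subdivision of `Γ` via the vertex embedding `f`. -/
def SubdivVia (f : α → β) (S : SimpleGraph β) (Γ : SimpleGraph α) : Prop :=
  Function.Injective f ∧
  (∀ b : β, b ∉ Set.range f → ∃ x y : β, x ≠ y ∧ S.neighborSet b = {x, y}) ∧
  (∀ u : α, Nonempty (Γ.neighborSet u ≃ S.neighborSet (f u))) ∧
  (∀ u v : α, Γ.Adj u v ↔ ∃ p : S.Walk (f u) (f v), p.IsPath ∧ 1 ≤ p.length ∧
      ∀ w ∈ p.support, w ∈ Set.range f → w = f u ∨ w = f v) ∧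
  (∀ e ∈ S.edgeSet, ∃ (u v : α) (p : S.Walk (f u) (f v)), Γ.Adj u v ∧ p.IsPath ∧
      (∀ w ∈ p.support, w ∈ Set.range f → w = f u ∨ w = f v) ∧ e ∈ p.edges)

/-- `S` is (isomorphic to) a subdivision of `Γ`. -/
def IsSubdivision (S : SimpleGraph β) (Γ : SimpleGraph α) : Prop :=
  ∃ f : α → β, SubdivVia f S Γ

end Subdiv

end SSRN

namespace SSRN

/-- Vertices of the subdivided tree of cylinders: vertices of `T`, cylinders, and
midpoints of edges `(v, Y)`. -/
def TcSubV (V : Type*) := V ⊕ (Set (Sym2 V) ⊕ (V × Set (Sym2 V)))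

variable {V : Type*}

/-- The vertex of the subdivided tree of cylinders corresponding to a vertex of `T`. -/
def tcv (v : V) : TcSubV V := Sum.inl v

/-- The vertex of the subdivided tree of cylinders corresponding to a cylinder. -/
def tcY (Y : Set (Sym2 V)) : TcSubV V := Sum.inr (Sum.inl Y)

/-- The midpoint of the edge `(v_c, Y_c)`. -/
def tcMid (v : V) (Y : Set (Sym2 V)) : TcSubV V := Sum.inr (Sum.inr (v, Y))

variable (T : SimpleGraph V)

/-- `(v, Y)` is an edge of the tree of cylinders. -/
def MidOK (G : Type*) [Group G] [MulAction G V] (v : V) (Y : Set (Sym2 V)) : Prop :=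
  IsCylinder T G Y ∧ v ∈ cylBoundary T Y

/-- Half of the adjacency relation of the subdivided tree of cylinders. -/
def TcHalfAdj (G : Type*) [Group G] [MulAction G V] (x y : TcSubV V) : Prop :=
  (∃ (v : V) (Y : Set (Sym2 V)), MidOK T G v Y ∧ x = tcv v ∧ y = tcMid v Y) ∨
  (∃ (v : V) (Y : Set (Sym2 V)), MidOK T G v Y ∧ x = tcY Y ∧ y = tcMid v Y)

/-- The subdivided tree of cylinders (each edge `(v_c, Y_c)` carries a midpoint). -/
def TcSub (G : Type*) [Group G] [MulAction G V] : SimpleGraph (TcSubV V) where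
  Adj x y := x ≠ y ∧ (TcHalfAdj T G x y ∨ TcHalfAdj T G y x)
  symm := ⟨fun x y h => ⟨h.1.symm, h.2.symm⟩⟩
  loopless := ⟨fun x h => h.1 rfl⟩

/-- `|∂Y| ≥ 3`. -/
def BigBoundary (Y : Set (Sym2 V)) : Prop :=
  ∃ a b c : V, a ∈ cylBoundary T Y ∧ b ∈ cylBoundary T Y ∧ c ∈ cylBoundary T Y ∧
    a ≠ b ∧ a ≠ c ∧ b ≠ c

/-- `|∂Y| = 2`. -/
def TwoBoundary (Y : Set (Sym2 V)) : Prop :=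
  ∃ a b : V, a ≠ b ∧ cylBoundary T Y = {a, b}

/-- The defining clauses of the map `Φ` from cross-connected components to the subdivided
tree of cylinders. -/
def PhiSpec (G : Type*) [Group G] [MulAction G V] (v₀ : V)
    (Φ : Set (Set G) → TcSubV V) : Prop :=
  (∀ (C : Set (Set G)) (Y : Set (Sym2 V)), IsCCC T G v₀ C → IsCylinder T G Y →
      CCCBasedOn G Y C → ¬ PeripheralCCC T G v₀ C → Φ C = tcY Y) ∧
  (∀ (Y : Set (Sym2 V)) (v : V), IsCylinder T G Y → v ∈ cylBoundary T Y →
      FiniteValenceIn Y v → BigBoundary T Y →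
      Φ (ccOf T G v₀ (XvY T G v₀ Y v)) = tcMid v Y) ∧
  (∀ (Y : Set (Sym2 V)) (v : V), IsCylinder T G Y → v ∈ cylBoundary T Y →
      FiniteValenceIn Y v → TwoBoundary T Y →
      Φ (ccOf T G v₀ (XvY T G v₀ Y v)) = tcY Y)

/-- `x` is the projection of `w` to the subtree `A`: the point of `A` between `w` and every
point of `A`. -/
def projIs (A : Set V) (w x : V) : Prop := x ∈ A ∧ ∀ a ∈ A, Btw T w x a

end SSRN

open scoped Pointwise symmDiff
namespace SSRN

section TreeHelpers
variable {V : Type*} {T : SimpleGraph V}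

lemma walk_cross {S : Set V} {x y : V} (p : T.Walk x y) (hx : x ∈ S) (hy : y ∉ S) :
    ∃ c d, T.Adj c d ∧ c ∈ S ∧ d ∉ S ∧ s(c, d) ∈ p.edges := by
  induction p with
  | nil => exact absurd hx hy
  | @cons a b c h q ih =>
    by_cases hb : b ∈ S
    · obtain ⟨c', d', h1, h2, h3, h4⟩ := ih hb hy
      exact ⟨c', d', h1, h2, h3, by simp [h4]⟩
    · exact ⟨a, b, h, hx, hb, by simp⟩

lemma path_unique' (hT : T.IsTree) {x y : V} {p q : T.Walk x y} (hp : p.IsPath)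
    (hq : q.IsPath) : p = q := (hT.existsUnique_path x y).unique hp hq

lemma exists_path (hT : T.IsTree) (x y : V) : ∃ p : T.Walk x y, p.IsPath :=
  (hT.existsUnique_path x y).exists

lemma mem_cobdry {S : Set V} {x y : V} (h : T.Adj x y) (hx : x ∈ S) (hy : y ∉ S) :
    s(x, y) ∈ cobdry T S := ⟨h, x, y, rfl, hx, hy⟩

lemma cobdry_compl (S : Set V) : cobdry T Sᶜ = cobdry T S := by
  ext e
  constructor
  · rintro ⟨he, u, v, rfl, hu, hv⟩
    exact ⟨he, v, u, Sym2.eq_swap, by simpa using hv, hu⟩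
  · rintro ⟨he, u, v, rfl, hu, hv⟩
    exact ⟨he, v, u, Sym2.eq_swap, hv, by simpa using hu⟩

lemma cobdry_inter (S S' : Set V) : cobdry T (S ∩ S') ⊆ cobdry T S ∪ cobdry T S' := by
  rintro e ⟨he, u, v, rfl, hu, hv⟩
  by_cases h : v ∈ S
  · exact Or.inr ⟨he, u, v, rfl, hu.2, fun h' => hv ⟨h, h'⟩⟩
  · exact Or.inl ⟨he, u, v, rfl, hu.1, h⟩

lemma cobdry_union (S S' : Set V) : cobdry T (S ∪ S') ⊆ cobdry T S ∪ cobdry T S' := by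
  rintro e ⟨he, u, v, rfl, hu, hv⟩
  rcases hu with hu | hu
  · exact Or.inl ⟨he, u, v, rfl, hu, fun h' => hv (Or.inl h')⟩
  · exact Or.inr ⟨he, u, v, rfl, hu, fun h' => hv (Or.inr h')⟩

lemma cobdry_empty (hT : T.IsTree) {S : Set V} (h : cobdry T S = ∅) : S = ∅ ∨ S = Set.univ := by
  by_contra hc
  push Not at hc
  obtain ⟨⟨x, hx⟩, h2⟩ := hc
  obtain ⟨y, hy⟩ := (Set.ne_univ_iff_exists_notMem S).1 h2
  obtain ⟨p, -⟩ := exists_path hT x y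
  obtain ⟨c, d, h1, h3, h4, -⟩ := walk_cross p hx hy
  have := mem_cobdry h1 h3 h4
  rw [h] at this
  exact this

lemma sf_compl {S : Set V} {Y} (h : IsSpecialForest T S Y) : IsSpecialForest T Sᶜ Y := by
  unfold IsSpecialForest; rw [cobdry_compl]; exact h

lemma sf_inter {S S' : Set V} {Y} (h : IsSpecialForest T S Y) (h' : IsSpecialForest T S' Y) :
    IsSpecialForest T (S ∩ S') Y :=
  ⟨(h.1.union h'.1).subset (cobdry_inter _ _),
    (cobdry_inter _ _).trans (Set.union_subset h.2 h'.2)⟩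

lemma sf_union {S S' : Set V} {Y} (h : IsSpecialForest T S Y) (h' : IsSpecialForest T S' Y) :
    IsSpecialForest T (S ∪ S') Y :=
  ⟨(h.1.union h'.1).subset (cobdry_union _ _),
    (cobdry_union _ _).trans (Set.union_subset h.2 h'.2)⟩

lemma sf_symmDiff {S S' : Set V} {Y} (h : IsSpecialForest T S Y) (h' : IsSpecialForest T S' Y) :
    IsSpecialForest T (S ∆ S') Y := by
  have : S ∆ S' = (S ∩ S'ᶜ) ∪ (S' ∩ Sᶜ) := by
    ext x; simp [Set.mem_symmDiff]
  rw [this]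
  exact sf_union (sf_inter h (sf_compl h')) (sf_inter h' (sf_compl h))

/-- Component of `v` in `T` minus the edges of `F`. -/
def Cmp (T : SimpleGraph V) (F : Set (Sym2 V)) (v : V) : Set V :=
  {w | ∃ p : T.Walk v w, ∀ e ∈ p.edges, e ∉ F}

variable {F : Set (Sym2 V)}

lemma Cmp_refl (v : V) : v ∈ Cmp T F v := ⟨.nil, by simp⟩

lemma Cmp_symm {v w : V} (h : w ∈ Cmp T F v) : v ∈ Cmp T F w := by
  obtain ⟨p, hp⟩ := h
  exact ⟨p.reverse, by simpa using hp⟩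

lemma Cmp_trans {u v w : V} (h : v ∈ Cmp T F u) (h' : w ∈ Cmp T F v) : w ∈ Cmp T F u := by
  obtain ⟨p, hp⟩ := h
  obtain ⟨q, hq⟩ := h'
  refine ⟨p.append q, fun e he => ?_⟩
  rw [SimpleGraph.Walk.edges_append, List.mem_append] at he
  exact he.elim (hp e) (hq e)

lemma Cmp_adj {x y : V} (h : T.Adj x y) (hF : s(x, y) ∉ F) : y ∈ Cmp T F x :=
  ⟨.cons h .nil, by simpa using hF⟩

lemma Cmp_path {v w : V} (h : w ∈ Cmp T F v) :
    ∃ p : T.Walk v w, p.IsPath ∧ ∀ e ∈ p.edges, e ∉ F := by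
  classical
  obtain ⟨p, hp⟩ := h
  exact ⟨p.bypass, p.bypass_isPath, fun e he => hp e (p.edges_bypass_subset_edges he)⟩

lemma Cmp_const {S : Set V} (h : cobdry T S ⊆ F) {x y : V} (hx : x ∈ S) (hy : y ∈ Cmp T F x) :
    y ∈ S := by
  by_contra hc
  obtain ⟨p, hp⟩ := hy
  obtain ⟨c, d, h1, h3, h4, h5⟩ := walk_cross p hx hc
  exact hp _ h5 (h (mem_cobdry h1 h3 h4))

lemma cobdry_Cmp (v : V) : cobdry T (Cmp T F v) ⊆ F := by
  rintro e ⟨he, x, y, rfl, hx, hy⟩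
  by_contra hc
  exact hy (Cmp_trans hx (Cmp_adj he hc))

/-- Vertices on a walk avoiding `F` are all in the component. -/
lemma Cmp_support {v w x : V} (p : T.Walk v w) (hp : ∀ e ∈ p.edges, e ∉ F)
    (hx : x ∈ p.support) : x ∈ Cmp T F v := by
  classical
  exact ⟨p.takeUntil x hx, fun e he => hp e (p.edges_takeUntil_subset_edges hx he)⟩

lemma halfTree_eq (u v : V) : halfTree T u v = Cmp T {s(u, v)} v := by
  ext w
  constructor
  · rintro ⟨p, -, hp⟩
    exact ⟨p, fun e he h => hp (by rw [Set.mem_singleton_iff] at h; rwa [h] at he)⟩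
  · intro h
    obtain ⟨p, hp, hp'⟩ := Cmp_path h
    exact ⟨p, hp, fun h => hp' _ h rfl⟩

lemma ht_right (u v : V) : v ∈ halfTree T u v := by rw [halfTree_eq]; exact Cmp_refl v

lemma ht_left (hT : T.IsTree) {u v : V} (h : T.Adj u v) : u ∉ halfTree T u v := by
  rintro ⟨p, hp, hp'⟩
  have h2 : (SimpleGraph.Walk.cons h.symm SimpleGraph.Walk.nil : T.Walk v u).IsPath := by
    simp [h.ne']
  rw [path_unique' hT hp h2] at hp'
  simp [Sym2.eq_swap] at hp'

lemma cobdry_ht (u v : V) : cobdry T (halfTree T u v) ⊆ {s(u, v)} := by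
  rw [halfTree_eq]; exact cobdry_Cmp v

lemma ht_disj (hT : T.IsTree) {u v x : V} (h : T.Adj u v) (h1 : x ∈ halfTree T u v) :
    x ∉ halfTree T v u := by
  intro h2
  apply ht_left hT h
  rw [halfTree_eq] at h1 h2 ⊢
  rw [Sym2.eq_swap] at h2
  exact Cmp_trans h1 (Cmp_symm h2)

/-- a walk leaving a half-tree goes through the edge -/
lemma ht_cross (hT : T.IsTree) {u v x y : V} (h : T.Adj u v) (p : T.Walk x y)
    (hx : x ∈ halfTree T u v) (hy : y ∉ halfTree T u v) : s(u, v) ∈ p.edges := by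
  obtain ⟨c, d, h1, h3, h4, h5⟩ := walk_cross p hx hy
  have := cobdry_ht u v (mem_cobdry h1 h3 h4)
  rw [Set.mem_singleton_iff] at this
  rwa [this] at h5

lemma ht_sub (hT : T.IsTree) {c d c' : V} (h : T.Adj c d) (h' : T.Adj d c') (hne : c' ≠ c) :
    halfTree T d c' ⊆ halfTree T c d := by
  intro z hz
  by_contra hc
  have h1 : c' ∈ halfTree T c d := by
    rw [halfTree_eq]
    apply Cmp_adj h'
    intro he
    rw [Set.mem_singleton_iff, Sym2.eq_iff] at he
    rcases he with ⟨h1, h2⟩ | ⟨h1, h2⟩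
    · exact h.ne h1.symm
    · exact hne h2
  obtain ⟨p, hp, hp'⟩ := hz
  have h2 := ht_cross hT h p h1 hc
  apply ht_left hT h'
  rw [halfTree_eq]
  exact Cmp_support p (fun e he h => hp' (by rw [Set.mem_singleton_iff] at h; rwa [h] at he))
    (p.snd_mem_support_of_mem_edges h2)

lemma ht_compl_convex (hT : T.IsTree) {a b x y w : V} (h : T.Adj a b) {p : T.Walk x y}
    (hp : p.IsPath) (hx : x ∉ halfTree T a b) (hy : y ∉ halfTree T a b) (hw : w ∈ p.support) :
    w ∉ halfTree T a b := by
  classical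
  intro hc
  have h1 := ht_cross hT h (p.takeUntil w hw).reverse hc hx
  have h2 := ht_cross hT h (p.dropUntil w hw) hc hy
  rw [SimpleGraph.Walk.edges_reverse, List.mem_reverse] at h1
  exact hp.isTrail.disjoint_edges_takeUntil_dropUntil hw h1 h2

lemma exists_ht_subset (hT : T.IsTree) {S : Set V} (hS : ¬ S.Finite) (hd : (cobdry T S).Finite)
    (u : V) : ∃ a b, T.Adj a b ∧ halfTree T a b ⊆ S ∧ u ∉ halfTree T a b := by
  by_contra hc
  push Not at hc
  choose P hP using fun c => exists_path hT u c
  apply hS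
  have hfin : ({u} ∪ ⋃ e ∈ cobdry T S, ⋃ c ∈ {c | c ∈ e}, {x | x ∈ (P c).support}).Finite := by
    refine (Set.finite_singleton u).union (hd.biUnion fun e _ => Set.Finite.biUnion ?_ ?_)
    · induction e using Sym2.ind with
      | _ x y => exact (Set.toFinite {x, y}).subset (by intro z; simp)
    · intro c _
      exact (P c).support.finite_toSet
  refine hfin.subset fun x hx => ?_
  by_cases hxu : x = u
  · exact Or.inl hxu
  right
  obtain ⟨p, hp⟩ := exists_path hT x u
  cases p with
  | nil => exact absurd rfl hxu
  | @cons _ y _ h q =>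
    rw [SimpleGraph.Walk.cons_isPath_iff] at hp
    have hu : u ∈ halfTree T x y :=
      ⟨q, hp.1, fun h' => hp.2 (q.fst_mem_support_of_mem_edges h')⟩
    have hu' : u ∉ halfTree T y x := ht_disj hT h hu
    have h3 : ¬ halfTree T y x ⊆ S := fun h4 => hu' (hc y x h.symm h4)
    obtain ⟨z, hz, hzS⟩ := Set.not_subset.1 h3
    obtain ⟨r, hr, hr'⟩ := hz
    obtain ⟨c, d, h1, h3, h4, h5⟩ := walk_cross r hx hzS
    have hcm : c ∈ halfTree T y x := by
      rw [halfTree_eq]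
      exact Cmp_support r (fun e he h => hr' (by rw [Set.mem_singleton_iff] at h; rwa [h] at he))
        (r.fst_mem_support_of_mem_edges h5)
    have h6 := ht_cross hT h.symm (P c).reverse hcm hu'
    rw [SimpleGraph.Walk.edges_reverse, List.mem_reverse] at h6
    simp only [Set.mem_iUnion]
    exact ⟨_, mem_cobdry h1 h3 h4, c, by simp, (P c).snd_mem_support_of_mem_edges h6⟩

lemma ht_far (hT : T.IsTree) (hv : ∀ d c : V, ∃ c', c' ≠ c ∧ T.Adj d c') (u : V) (n : ℕ)
    {a b : V} (h : T.Adj a b) (hu : u ∉ halfTree T a b) :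
    ∃ c d, T.Adj c d ∧ halfTree T c d ⊆ halfTree T a b ∧ ∀ z ∈ halfTree T c d, n ≤ T.dist u z := by
  classical
  induction n with
  | zero => exact ⟨a, b, h, subset_rfl, by simp⟩
  | succ n ih =>
    obtain ⟨c, d, hcd, hsub, hdist⟩ := ih
    obtain ⟨c', hne, hadj⟩ := hv d c
    have hs := ht_sub hT hcd hadj hne
    refine ⟨d, c', hadj, hs.trans hsub, fun z hz => ?_⟩
    obtain ⟨p, hp⟩ := hT.connected.exists_walk_length_eq_dist u z
    have hu' : u ∉ halfTree T d c' := fun h' => hu (hsub (hs h'))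
    have h6 := ht_cross hT hadj p.reverse hz hu'
    rw [SimpleGraph.Walk.edges_reverse, List.mem_reverse] at h6
    have hd := p.fst_mem_support_of_mem_edges h6
    have hdz : d ≠ z := fun h' => ht_left hT hadj (h' ▸ hz)
    have h1 := SimpleGraph.Walk.length_takeUntil_lt_length hd hdz
    have h2 := SimpleGraph.dist_le (p.takeUntil d hd)
    have h3 := hdist d (ht_right c d)
    omega

lemma ht_infinite (hT : T.IsTree) (hv : ∀ d c : V, ∃ c', c' ≠ c ∧ T.Adj d c')
    {a b : V} (h : T.Adj a b) : ¬ (halfTree T a b).Finite := by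
  intro hf
  obtain ⟨N, hN⟩ := (hf.image (T.dist a)).bddAbove
  obtain ⟨c, d, -, hsub, hd⟩ := ht_far hT hv a (N + 1) h (ht_left hT h)
  have h1 := hd d (ht_right c d)
  have h2 := hN ⟨d, hsub (ht_right c d), rfl⟩
  omega

end TreeHelpers
end SSRN

open scoped Pointwise symmDiff
namespace SSRN

/-- The standing assumptions. -/
structure Ctx {V : Type*} (T : SimpleGraph V) (G : Type*) [Group G] [MulAction G V] : Prop where
  tree : T.IsTree
  act : ActsOn T G
  inv : NoInversions T G
  adm : ∃ E : Set (Subgroup G), Admissible E ∧ IsETree T G E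
  min : MinimalAction T G
  val3 : ∀ w : V, ∃ a b c : V, a ≠ b ∧ a ≠ c ∧ b ≠ c ∧ T.Adj w a ∧ T.Adj w b ∧ T.Adj w c
  many : ∃ Y₁ Y₂ : Set (Sym2 V), IsCylinder T G Y₁ ∧ IsCylinder T G Y₂ ∧ Y₁ ≠ Y₂

section ActHelpers
variable {V : Type*} {T : SimpleGraph V} {G : Type*} [Group G] [MulAction G V]

lemma Ctx.val2 (c : Ctx T G) : ∀ d c : V, ∃ c', c' ≠ c ∧ T.Adj d c' := by
  intro d x
  obtain ⟨a, b, -, hab, -, -, ha, hb, -⟩ := c.val3 d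
  by_cases h : a = x
  · exact ⟨b, fun h' => hab (h.trans h'.symm), hb⟩
  · exact ⟨a, h, ha⟩

/-- The graph homomorphism given by a group element. -/
def smulHom (h : ActsOn T G) (g : G) : T →g T := ⟨(g • ·), fun {a b} hab => h g a b hab⟩

lemma mem_edgeStab {g : G} {e : Sym2 V} : g ∈ edgeStab G e ↔ Sym2.map (g • ·) e = e := Iff.rfl

lemma Ctx.stab_fix (c : Ctx T G) {u v : V} (h : T.Adj u v) {g : G} (hg : g ∈ edgeStab G s(u, v)) :
    g • u = u ∧ g • v = v := by
  rw [mem_edgeStab, Sym2.map_mk, Sym2.eq_iff] at hg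
  rcases hg with hg | hg
  · exact hg
  · exact absurd hg (c.inv g u v h)

lemma Ctx.stab_fix' (c : Ctx T G) {e : Sym2 V} (he : e ∈ T.edgeSet) {v : V} (hv : v ∈ e) {g : G}
    (hg : g ∈ edgeStab G e) : g • v = v := by
  induction e using Sym2.ind with
  | _ x y =>
    have := c.stab_fix he hg
    rw [Sym2.mem_iff] at hv
    rcases hv with rfl | rfl
    · exact this.1
    · exact this.2

lemma Ctx.adj_smul (c : Ctx T G) (g : G) {u v : V} : T.Adj (g • u) (g • v) ↔ T.Adj u v := by
  constructor
  · intro h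
    simpa using c.act g⁻¹ _ _ h
  · exact c.act g u v

lemma Ctx.path_smul (c : Ctx T G) (g : G) {u v : V} {p : T.Walk u v} (hp : p.IsPath) :
    ∃ q : T.Walk (g • u) (g • v), q.IsPath ∧ q.support = p.support.map (g • ·) ∧
      q.edges = p.edges.map (Sym2.map (g • ·)) :=
  ⟨p.map (smulHom c.act g),
    SimpleGraph.Walk.map_isPath_of_injective (f := smulHom c.act g) (MulAction.injective g) hp,
    SimpleGraph.Walk.support_map (smulHom c.act g) p, SimpleGraph.Walk.edges_map (smulHom c.act g) p⟩

lemma Ctx.btw_smul (c : Ctx T G) (g : G) {u w v : V} (h : Btw T u w v) :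
    Btw T (g • u) (g • w) (g • v) := by
  intro q hq
  obtain ⟨p, hp⟩ := exists_path c.tree u v
  obtain ⟨q', h1, h3, -⟩ := c.path_smul g hp
  rw [path_unique' c.tree hq h1, h3, List.mem_map]
  exact ⟨w, h p hp, rfl⟩

lemma Ctx.dist_smul_le (c : Ctx T G) (g : G) (u v : V) : T.dist (g • u) (g • v) ≤ T.dist u v := by
  obtain ⟨p, hp⟩ := c.tree.connected.exists_walk_length_eq_dist u v
  rw [← hp, ← SimpleGraph.Walk.length_map (smulHom c.act g) p]
  exact SimpleGraph.dist_le _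

lemma Ctx.dist_smul (c : Ctx T G) (g : G) (u v : V) : T.dist (g • u) (g • v) = T.dist u v := by
  apply le_antisymm (c.dist_smul_le g u v)
  simpa using c.dist_smul_le g⁻¹ (g • u) (g • v)

lemma list_map_fix {α : Type*} {f : α → α} {l : List α} (h : l.map f = l) : ∀ a ∈ l, f a = a := by
  induction l with
  | nil => simp
  | cons b l ih =>
    simp only [List.map_cons, List.cons.injEq] at h
    intro a ha
    rcases List.mem_cons.1 ha with rfl | ha
    · exact h.1
    · exact ih h.2 a ha

lemma Ctx.fix_path (c : Ctx T G) {g : G} {x y : V} (hx : g • x = x) (hy : g • y = y)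
    {p : T.Walk x y} (hp : p.IsPath) : ∀ f ∈ p.edges, g ∈ edgeStab G f := by
  obtain ⟨q, h1, -, h4⟩ := c.path_smul g hp
  have h2 := path_unique' c.tree (p := q.copy hx hy) (by simpa using h1) hp
  have h3 : p.edges.map (Sym2.map (g • ·)) = p.edges := by
    rw [← h4]
    conv_rhs => rw [← h2]
    rw [SimpleGraph.Walk.edges_copy]
  exact list_map_fix h3

lemma Ctx.orbit_ht (c : Ctx T G) {a b : V} (h : T.Adj a b) (v : V) :
    ∃ g : G, g • v ∈ halfTree T a b := by
  by_contra hc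
  push Not at hc
  have := c.min {x | ∀ g : G, g • x ∉ halfTree T a b} ⟨v, hc⟩
    (fun g x hx g' => by rw [← mul_smul]; exact hx _)
    (fun u hu v hv w hw g => by
      obtain ⟨p, hp⟩ := exists_path c.tree (g • u) (g • v)
      exact ht_compl_convex c.tree h hp (hu g) (hv g) (c.btw_smul g hw p hp))
  have hb : b ∈ {x | ∀ g : G, g • x ∉ halfTree T a b} := by rw [this]; trivial
  have := hb 1
  rw [one_smul] at this
  exact this (ht_right a b)

/-! Cylinders -/

lemma cyl_comm {Y : Set (Sym2 V)} (hY : IsCylinder T G Y) {e e' : Sym2 V} (he : e ∈ Y)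
    (he' : e' ∈ Y) : Subgroup.Commensurable (edgeStab G e) (edgeStab G (V := V) e') :=
  (hY.2.2 e he e' (hY.2.1 he')).1 he'

lemma cyl_eq {Y Y' : Set (Sym2 V)} (hY : IsCylinder T G Y) (hY' : IsCylinder T G Y')
    {e e' : Sym2 V} (he : e ∈ Y) (he' : e' ∈ Y')
    (h : Subgroup.Commensurable (edgeStab G e) (edgeStab G (V := V) e')) : Y = Y' := by
  ext f
  constructor
  · intro hf
    exact (hY'.2.2 e' he' f (hY.2.1 hf)).2 (h.symm.trans (cyl_comm hY he hf))
  · intro hf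
    exact (hY.2.2 e he f (hY'.2.1 hf)).2 (h.trans (cyl_comm hY' he' hf))

lemma cyl_eq_of_mem {Y Y' : Set (Sym2 V)} (hY : IsCylinder T G Y) (hY' : IsCylinder T G Y')
    {e : Sym2 V} (he : e ∈ Y) (he' : e ∈ Y') : Y = Y' :=
  cyl_eq hY hY' he he' (Subgroup.Commensurable.refl _)

lemma cyl_exists {e : Sym2 V} (he : e ∈ T.edgeSet) : ∃ Y, IsCylinder T G Y ∧ e ∈ Y := by
  refine ⟨{f | f ∈ T.edgeSet ∧ Subgroup.Commensurable (edgeStab G e) (edgeStab G f)},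
    ⟨⟨e, he, Subgroup.Commensurable.refl _⟩, fun f hf => hf.1, ?_⟩,
    he, Subgroup.Commensurable.refl _⟩
  intro f hf f' hf'
  exact ⟨fun h => hf.2.symm.trans h.2, fun h => ⟨hf', hf.2.trans h⟩⟩

lemma comm_inf {H K : Subgroup G} (h : Subgroup.Commensurable H K) :
    Subgroup.Commensurable (H ⊓ K) H := by
  constructor
  · rw [Subgroup.inf_relIndex_left]; exact h.2
  · rw [Subgroup.relIndex_eq_one.2 inf_le_left]; exact one_ne_zero

lemma Ctx.cyl_convex (c : Ctx T G) {Y : Set (Sym2 V)} (hY : IsCylinder T G Y) {u v : V}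
    (hu : u ∈ cylVerts Y) (hv : v ∈ cylVerts Y) {p : T.Walk u v} (hp : p.IsPath) :
    ∀ f ∈ p.edges, f ∈ Y := by
  intro f hf
  obtain ⟨e1, he1, hu⟩ := hu
  obtain ⟨e2, he2, hv⟩ := hv
  obtain ⟨E, hE, hET⟩ := c.adm
  have hfe := p.edges_subset_edgeSet hf
  have hle : edgeStab G e1 ⊓ edgeStab G e2 ≤ edgeStab G f := by
    intro g hg
    exact c.fix_path (c.stab_fix' (hY.2.1 he1) hu hg.1) (c.stab_fix' (hY.2.1 he2) hv hg.2) hp f hf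
  have hcm := comm_inf (cyl_comm hY he1 he2)
  have h1 : edgeStab G e1 ⊓ edgeStab G e2 ∈ E := hE.2.1 _ (hET e1 (hY.2.1 he1)) _ hcm
  have h2 := hE.2.2 _ h1 _ (hET f hfe) hle
  have h3 : Subgroup.Commensurable (edgeStab G e1 ⊓ edgeStab G e2) (edgeStab G f) := by
    refine ⟨h2, ?_⟩
    rw [Subgroup.relIndex_eq_one.2 hle]; exact one_ne_zero
  exact (hY.2.2 e1 he1 f hfe).2 (hcm.symm.trans h3)

lemma edgeStab_map (g : G) (e : Sym2 V) :
    edgeStab G (Sym2.map (g • ·) e) = ConjAct.toConjAct g • edgeStab G e := by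
  ext x
  rw [Subgroup.mem_pointwise_smul_iff_inv_smul_mem, mem_edgeStab, mem_edgeStab,
    ← ConjAct.toConjAct_inv, ConjAct.toConjAct_smul, Sym2.map_map]
  induction e using Sym2.ind with
  | _ a b =>
    simp only [Sym2.map_mk, Function.comp, inv_inv, mul_smul, Sym2.eq_iff, inv_smul_eq_iff]

lemma comm_map (g : G) {e f : Sym2 V}
    (h : Subgroup.Commensurable (edgeStab G (Sym2.map (g • ·) e))
      (edgeStab G (Sym2.map (g • ·) f))) :
    Subgroup.Commensurable (edgeStab G e) (edgeStab G f) := by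
  rw [edgeStab_map, edgeStab_map] at h
  exact (Subgroup.Commensurable.commensurable_conj _).2 h

lemma Ctx.map_edge (c : Ctx T G) (g : G) {e : Sym2 V} (he : e ∈ T.edgeSet) :
    Sym2.map (g • ·) e ∈ T.edgeSet := by
  induction e using Sym2.ind with
  | _ a b => exact c.act g a b he

lemma Ctx.bdry_smul (c : Ctx T G) {Y Z : Set (Sym2 V)} (hY : IsCylinder T G Y)
    (hZ : IsCylinder T G Z) {v : V} (hv : v ∈ cylBoundary T Y) {g : G}
    (hg : g • v ∈ cylVerts Z) : g • v ∈ cylBoundary T Z := by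
  refine ⟨hg, ?_⟩
  obtain ⟨⟨e, he, hve⟩, f, hf, hvf, hfY⟩ := hv
  by_contra hc
  push Not at hc
  have h1 := hc _ (c.map_edge g (hY.2.1 he)) (Sym2.mem_map.2 ⟨v, hve, rfl⟩)
  have h2 := hc _ (c.map_edge g hf) (Sym2.mem_map.2 ⟨v, hvf, rfl⟩)
  exact hfY ((hY.2.2 e he f hf).2 (comm_map g (cyl_comm hZ h1 h2)))

lemma bdry_of_two {Y Z : Set (Sym2 V)} (hY : IsCylinder T G Y) (hZ : IsCylinder T G Z)
    (hne : Y ≠ Z) {v : V} (h1 : v ∈ cylVerts Y) (h2 : v ∈ cylVerts Z) : v ∈ cylBoundary T Y := by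
  obtain ⟨e, he, hv⟩ := h2
  exact ⟨h1, e, hZ.2.1 he, hv, fun h => hne (cyl_eq_of_mem hY hZ h he)⟩

lemma Ctx.cmp_inter (c : Ctx T G) {Y : Set (Sym2 V)} (hY : IsCylinder T G Y) {η a : V}
    (hη : η ∈ cylVerts Y) (ha : a ∈ cylVerts Y) (h : a ∈ Cmp T Y η) : a = η := by
  obtain ⟨p, hp, hp'⟩ := Cmp_path h
  cases p with
  | nil => rfl
  | @cons _ x _ h q =>
    exact absurd (c.cyl_convex hY hη ha hp s(η, x) (by simp)) (hp' s(η, x) (by simp))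

lemma Ctx.cmp_exists (c : Ctx T G) {Y : Set (Sym2 V)} (hY : IsCylinder T G Y) (w : V) :
    ∃ η ∈ cylVerts Y, w ∈ Cmp T Y η := by
  have h : cobdry T {w | ∃ η ∈ cylVerts Y, w ∈ Cmp T Y η} = ∅ := by
    rw [Set.eq_empty_iff_forall_notMem]
    rintro e ⟨he, x, y, rfl, ⟨η, hη, hx⟩, hy⟩
    apply hy
    by_cases hxy : s(x, y) ∈ Y
    · exact ⟨y, ⟨_, hxy, by simp⟩, Cmp_refl y⟩
    · exact ⟨η, hη, Cmp_trans hx (Cmp_adj he hxy)⟩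
  rcases cobdry_empty c.tree h with h | h
  · obtain ⟨e, he⟩ := hY.1
    exfalso
    induction e using Sym2.ind with
    | _ a b =>
      have : a ∈ {w | ∃ η ∈ cylVerts Y, w ∈ Cmp T Y η} := ⟨a, ⟨_, he, by simp⟩, Cmp_refl a⟩
      rw [h] at this
      exact this
  · have : w ∈ {w | ∃ η ∈ cylVerts Y, w ∈ Cmp T Y η} := by rw [h]; trivial
    exact this

lemma Ctx.cobdry_cmp (c : Ctx T G) {Y : Set (Sym2 V)} (hY : IsCylinder T G Y) {η : V}
    (hη : η ∈ cylVerts Y) : cobdry T (Cmp T Y η) ⊆ {e | e ∈ Y ∧ η ∈ e} := by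
  intro e he
  have h1 := cobdry_Cmp η he
  obtain ⟨_, x, y, rfl, hx, hy⟩ := he
  have := c.cmp_inter hY hη ⟨_, h1, by simp⟩ hx
  exact ⟨h1, by simp [this]⟩

lemma Ctx.proj_of_cmp (c : Ctx T G) {Y : Set (Sym2 V)} (hY : IsCylinder T G Y) {η w : V}
    (hη : η ∈ cylVerts Y) (hw : w ∈ Cmp T Y η) : projIs T (cylVerts Y) w η := by
  refine ⟨hη, fun a ha p hp => ?_⟩
  by_cases hae : a ∈ Cmp T Y η
  · rw [← c.cmp_inter hY hη ha hae]; simp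
  · obtain ⟨x, d, h1, h3, h4, h5⟩ := walk_cross p hw hae
    have h6 := c.cobdry_cmp hY hη (mem_cobdry h1 h3 h4)
    exact p.mem_support_of_mem_edges h5 h6.2

lemma Ctx.proj_iff (c : Ctx T G) {Y : Set (Sym2 V)} (hY : IsCylinder T G Y) {η w : V}
    (hη : η ∈ cylVerts Y) : projIs T (cylVerts Y) w η ↔ w ∈ Cmp T Y η := by
  classical
  refine ⟨fun h => ?_, c.proj_of_cmp hY hη⟩
  obtain ⟨η', hη', hw⟩ := c.cmp_exists hY w
  have h' := c.proj_of_cmp hY hη' hw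
  obtain ⟨p, hp⟩ := exists_path c.tree w η
  have h1 := h'.2 η hη p hp
  have h2 := h.2 η' hη' _ (hp.takeUntil h1)
  by_cases he : η' = η
  · rwa [← he]
  · exact absurd h2 (SimpleGraph.Walk.endpoint_notMem_support_takeUntil hp h1 (fun h => he h.symm))

lemma Ctx.peri_eq (c : Ctx T G) {Y : Set (Sym2 V)} (hY : IsCylinder T G Y) {v : V}
    (hv : v ∈ cylVerts Y) : periForest T Y v = Cmp T Y v := by
  classical
  ext w
  constructor
  · rintro ⟨p, hp, hp'⟩
    obtain ⟨η, hη, hw⟩ := c.cmp_exists hY w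
    by_cases he : v = η
    · rwa [he]
    exfalso
    have h1 := (c.proj_of_cmp hY hη hw).2 v hv p.reverse hp.reverse
    rw [SimpleGraph.Walk.support_reverse, List.mem_reverse] at h1
    have h2 := c.cyl_convex hY hv hη (hp.takeUntil h1)
    have h3 : ∀ e ∈ (p.takeUntil η h1).edges, e ∈ p.edges :=
      fun e h => p.edges_takeUntil_subset_edges h1 h
    generalize p.takeUntil η h1 = q at h2 h3
    cases q with
    | nil => exact he rfl
    | @cons _ x _ h q =>
      exact hp' s(v, x) (h2 s(v, x) (by simp)) (by simp) (h3 s(v, x) (by simp))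
  · intro h
    obtain ⟨p, hp, hp'⟩ := Cmp_path h
    exact ⟨p, hp, fun e he _ h' => hp' e h' he⟩

lemma bdry_of_cmp {Y : Set (Sym2 V)} {η w : V}
    (hη : η ∈ cylVerts Y) (hw : w ∈ Cmp T Y η) (hne : w ≠ η) : η ∈ cylBoundary T Y := by
  obtain ⟨p, hp⟩ := hw
  cases p with
  | nil => exact absurd rfl hne
  | @cons _ x _ h q =>
    exact ⟨hη, s(η, x), h, by simp, hp _ (by simp)⟩

lemma Ctx.bdry_nonempty (c : Ctx T G) {Y : Set (Sym2 V)} (hY : IsCylinder T G Y) :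
    ∃ v, v ∈ cylBoundary T Y := by
  have : ∃ Z, IsCylinder T G Z ∧ Z ≠ Y := by
    obtain ⟨Y1, Y2, h1, h2, hne⟩ := c.many
    by_cases h : Y1 = Y
    · exact ⟨Y2, h2, fun h' => hne (h.trans h'.symm)⟩
    · exact ⟨Y1, h1, h⟩
  obtain ⟨Z, hZ, hne⟩ := this
  obtain ⟨e, he⟩ := hZ.1
  have hx : ∃ x, x ∈ e := by
    induction e using Sym2.ind with
    | _ a b => exact ⟨a, by simp⟩
  obtain ⟨x, hx⟩ := hx
  obtain ⟨η, hη, hw⟩ := c.cmp_exists hY x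
  by_cases h : x = η
  · exact ⟨η, bdry_of_two hY hZ (Ne.symm hne) hη ⟨e, he, h ▸ hx⟩⟩
  · exact ⟨η, bdry_of_cmp hη hw h⟩

lemma Ctx.cyl_const (c : Ctx T G) {Y Y' : Set (Sym2 V)} (hY : IsCylinder T G Y)
    (hY' : IsCylinder T G Y') (hne : Y' ≠ Y) {S : Set V} (hS : IsSpecialForest T S Y') {x y : V}
    (hx : x ∈ cylVerts Y) (hy : y ∈ cylVerts Y) (h : x ∈ S) : y ∈ S := by
  by_contra hc
  obtain ⟨p, hp⟩ := exists_path c.tree x y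
  obtain ⟨a, d, h1, h3, h4, h5⟩ := walk_cross p h hc
  exact hne (cyl_eq_of_mem hY' hY (hS.2 (mem_cobdry h1 h3 h4)) (c.cyl_convex hY hx hy hp _ h5))

lemma Ctx.sf_inf_of_bdry (c : Ctx T G) {Y : Set (Sym2 V)} (hY : IsCylinder T G Y) {D : Set V}
    (hD : IsSpecialForest T D Y) {v : V} (hv : v ∈ cylBoundary T Y) (hvD : v ∈ D) :
    ¬ D.Finite := by
  obtain ⟨hvY, f, hf, hvf, hfY⟩ := hv
  obtain ⟨x, rfl⟩ := Sym2.mem_iff_exists.1 hvf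
  have hadj : T.Adj v x := hf
  have hsub : halfTree T v x ⊆ D := by
    intro z hz
    by_contra hzD
    have hx : x ∈ D := by
      by_contra hx
      exact hfY (hD.2 (mem_cobdry hadj hvD hx))
    obtain ⟨r, hr, hr'⟩ := hz
    obtain ⟨a, d, h1, h3, h4, h5⟩ := walk_cross r hx hzD
    have ham : a ∈ halfTree T v x := by
      rw [halfTree_eq]
      exact Cmp_support r (fun e he h => hr' (by rw [Set.mem_singleton_iff] at h; rwa [h] at he))
        (r.fst_mem_support_of_mem_edges h5)
    have haY : a ∈ cylVerts Y := ⟨_, hD.2 (mem_cobdry h1 h3 h4), by simp⟩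
    obtain ⟨p, hp⟩ := exists_path c.tree a v
    exact hfY (c.cyl_convex hY haY hvY hp _
      (ht_cross c.tree hadj p ham (ht_left c.tree hadj)))
  exact fun h => ht_infinite c.tree c.val2 hadj (h.subset hsub)

lemma Ctx.bdry_of_sf_inf (c : Ctx T G) {Y : Set (Sym2 V)} (hY : IsCylinder T G Y) {D : Set V}
    (hD : IsSpecialForest T D Y) (hinf : ¬ D.Finite) : ∃ v ∈ cylBoundary T Y, v ∈ D := by
  obtain ⟨v, hv⟩ := c.bdry_nonempty hY
  obtain ⟨a, b, hab, hsub, -⟩ := exists_ht_subset c.tree hinf hD.1 v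
  obtain ⟨g, hg⟩ := c.orbit_ht hab v
  obtain ⟨η, hη, hw⟩ := c.cmp_exists hY (g • v)
  have hηD : η ∈ D := Cmp_const hD.2 (hsub hg) (Cmp_symm hw)
  by_cases h : g • v = η
  · exact ⟨η, h ▸ c.bdry_smul hY hY hv (h ▸ hη), hηD⟩
  · exact ⟨η, bdry_of_cmp hη hw h, hηD⟩

lemma sf_ht {Y : Set (Sym2 V)} {u v : V} (h : s(u, v) ∈ Y) :
    IsSpecialForest T (halfTree T u v) Y :=
  ⟨(Set.finite_singleton _).subset (cobdry_ht u v),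
    (cobdry_ht u v).trans (Set.singleton_subset_iff.2 h)⟩

lemma Ctx.finite_valence (c : Ctx T G) {Y : Set (Sym2 V)} (hY : IsCylinder T G Y) {S : Set V}
    (hS : IsSpecialForest T S Y) {v : V} (hv : v ∈ S)
    (h : ∀ w ∈ cylBoundary T Y, w ∈ S → w = v) : FiniteValenceIn Y v := by
  have key : ∀ x, s(v, x) ∈ Y → ∃ d ∈ halfTree T v x, ∃ e ∈ cobdry T S, d ∈ e := by
    intro x hx
    have hadj : T.Adj v x := hY.2.1 hx
    obtain ⟨z, hz, hzm⟩ := c.bdry_of_sf_inf hY (sf_ht hx) (ht_infinite c.tree c.val2 hadj)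
    have hzv : z ≠ v := fun h => ht_left c.tree hadj (h ▸ hzm)
    have hzS : z ∉ S := fun h' => hzv (h z hz h')
    by_cases hxS : x ∈ S
    · obtain ⟨r, hr, hr'⟩ := hzm
      obtain ⟨a, d, h1, h3, h4, h5⟩ := walk_cross r hxS hzS
      have ham : a ∈ halfTree T v x := by
        rw [halfTree_eq]
        exact Cmp_support r
          (fun e he h => hr' (by rw [Set.mem_singleton_iff] at h; rwa [h] at he))
          (r.fst_mem_support_of_mem_edges h5)
      exact ⟨a, ham, _, mem_cobdry h1 h3 h4, by simp⟩
    · exact ⟨x, ht_right v x, _, mem_cobdry hadj hv hxS, by simp⟩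
  have hends : {d | ∃ e ∈ cobdry T S, d ∈ e}.Finite := by
    have : {d | ∃ e ∈ cobdry T S, d ∈ e} = ⋃ e ∈ cobdry T S, {d | d ∈ e} := by ext; simp
    rw [this]
    refine hS.1.biUnion fun e _ => ?_
    induction e using Sym2.ind with
    | _ x y => exact (Set.toFinite {x, y}).subset (by intro z; simp)
  choose! d hd1 hd2 using key
  have hN : {x | s(v, x) ∈ Y}.Finite := by
    refine Set.Finite.of_finite_image (f := d) (hends.subset ?_) ?_
    · rintro _ ⟨x, hx, rfl⟩
      exact hd2 x hx
    · intro x hx x' hx' heq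
      by_contra hne
      have hadj : T.Adj v x := hY.2.1 hx
      have hadj' : T.Adj v x' := hY.2.1 hx'
      have h1 := ht_sub c.tree hadj.symm hadj' (Ne.symm hne) (hd1 x' hx')
      rw [← heq] at h1
      exact ht_disj c.tree hadj (hd1 x hx) h1
  refine (hN.image (fun x => s(v, x))).subset ?_
  rintro e ⟨he, hve⟩
  obtain ⟨x, rfl⟩ := Sym2.mem_iff_exists.1 hve
  exact ⟨x, he, rfl⟩

lemma Ctx.sf_peri (c : Ctx T G) {Y : Set (Sym2 V)} (hY : IsCylinder T G Y) {v : V}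
    (hv : v ∈ cylVerts Y) (hf : FiniteValenceIn Y v) : IsSpecialForest T (periForest T Y v) Y := by
  rw [c.peri_eq hY hv]
  exact ⟨Set.Finite.subset hf (c.cobdry_cmp hY hv), cobdry_Cmp v⟩

lemma Ctx.peri_of_single (c : Ctx T G) {Y : Set (Sym2 V)} (hY : IsCylinder T G Y) {S : Set V}
    (hS : IsSpecialForest T S Y) {v : V} (hvb : v ∈ cylBoundary T Y) (hv : v ∈ S)
    (h : ∀ w ∈ cylBoundary T Y, w ∈ S → w = v) :
    FiniteValenceIn Y v ∧ (S ∆ periForest T Y v).Finite := by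
  have hfv := c.finite_valence hY hS hv h
  refine ⟨hfv, ?_⟩
  by_contra hinf
  obtain ⟨w, hw, hwm⟩ := c.bdry_of_sf_inf hY (sf_symmDiff hS (c.sf_peri hY hvb.1 hfv)) hinf
  rw [c.peri_eq hY hvb.1] at hwm
  rcases hwm with ⟨h1, h2⟩ | ⟨h1, h2⟩
  · rw [h w hw h1] at h2
    exact h2 (Cmp_refl v)
  · rw [c.cmp_inter hY hvb.1 hw.1 h1] at h2
    exact h2 hv

end ActHelpers
end SSRN

open scoped Pointwise symmDiff
namespace SSRN
section HF
variable {G : Type*} [Group G]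

lemma hfin_iff {H : Subgroup G} {X : Set G} :
    HFin H X ↔ ∃ F : Finset G, ∀ x ∈ X, ∃ f ∈ F, x * f⁻¹ ∈ H := by
  unfold HFin
  constructor
  · rintro ⟨F, hF⟩
    refine ⟨F, fun x hx => ?_⟩
    obtain ⟨f, hf, h, hh, rfl⟩ := Set.mem_iUnion₂.1 (hF hx)
    exact ⟨f, hf, by simpa using hh⟩
  · rintro ⟨F, hF⟩
    refine ⟨F, fun x hx => ?_⟩
    obtain ⟨f, hf, h⟩ := hF x hx
    exact Set.mem_iUnion₂.2 ⟨f, hf, x * f⁻¹, h, by simp⟩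

lemma HFin.mono {H : Subgroup G} {X X' : Set G} (h : HFin H X') (hs : X ⊆ X') : HFin H X := by
  obtain ⟨F, hF⟩ := h
  exact ⟨F, hs.trans hF⟩

lemma HFin.empty (H : Subgroup G) : HFin H ∅ := ⟨∅, by simp⟩

lemma HFin.union {H : Subgroup G} {X X' : Set G} (h : HFin H X) (h' : HFin H X') :
    HFin H (X ∪ X') := by
  classical
  rw [hfin_iff] at *
  obtain ⟨F, hF⟩ := h
  obtain ⟨F', hF'⟩ := h'
  refine ⟨F ∪ F', ?_⟩
  rintro x (hx | hx)
  · obtain ⟨f, hf, h⟩ := hF x hx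
    exact ⟨f, Finset.mem_union_left _ hf, h⟩
  · obtain ⟨f, hf, h⟩ := hF' x hx
    exact ⟨f, Finset.mem_union_right _ hf, h⟩

lemma HFin.biUnion {ι : Type*} {H : Subgroup G} {A : Set ι} (hA : A.Finite) {X : ι → Set G}
    (h : ∀ i ∈ A, HFin H (X i)) : HFin H (⋃ i ∈ A, X i) := by
  induction A, hA using Set.Finite.induction_on with
  | empty => simpa using HFin.empty H
  | @insert a s _ _ ih =>
    rw [Set.biUnion_insert]
    exact (h a (by simp)).union (ih fun i hi => h i (by simp [hi]))

lemma HFin.rmul {H : Subgroup G} {X : Set G} (h : HFin H X) (s : G) :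
    HFin H ((· * s) '' X) := by
  classical
  rw [hfin_iff] at *
  obtain ⟨F, hF⟩ := h
  refine ⟨F.image (· * s), ?_⟩
  rintro _ ⟨x, hx, rfl⟩
  obtain ⟨f, hf, h⟩ := hF x hx
  exact ⟨f * s, Finset.mem_image_of_mem _ hf, by simpa [mul_assoc] using h⟩

lemma hfin_coset (H : Subgroup G) (s : G) : HFin H {x | x * s ∈ H} := by
  rw [hfin_iff]
  exact ⟨{s⁻¹}, fun x hx => ⟨s⁻¹, by simp, by simpa using hx⟩⟩

lemma hfin_self_of_relIndex {H K : Subgroup G} (h : K.relIndex H ≠ 0) : HFin K (H : Set G) := by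
  classical
  rw [hfin_iff]
  have : (K.subgroupOf H).FiniteIndex := ⟨h⟩
  have : Fintype (H ⧸ K.subgroupOf H) := Fintype.ofFinite _
  refine ⟨Finset.univ.image (fun q : H ⧸ K.subgroupOf H => ((q.out : H) : G)⁻¹), fun x hx => ?_⟩
  refine ⟨_, Finset.mem_image_of_mem _ (Finset.mem_univ
    (QuotientGroup.mk (s := K.subgroupOf H) (⟨x, hx⟩⁻¹ : H))), ?_⟩
  have h1 := Quotient.out_eq (QuotientGroup.mk (s := K.subgroupOf H) (⟨x, hx⟩⁻¹ : H))
  have h2 := QuotientGroup.eq.1 h1.symm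
  rw [Subgroup.mem_subgroupOf] at h2
  simpa using h2

lemma relIndex_of_hfin {H K : Subgroup G} (h : HFin K (H : Set G)) : K.relIndex H ≠ 0 := by
  rw [hfin_iff] at h
  obtain ⟨F, hF⟩ := h
  have : ∀ q : H ⧸ K.subgroupOf H, ∃ f : F, ((q.out : H) : G)⁻¹ * (f : G)⁻¹ ∈ K := by
    intro q
    obtain ⟨f, hf, h⟩ := hF ((q.out : H) : G)⁻¹ (H.inv_mem q.out.2)
    exact ⟨⟨f, hf⟩, h⟩
  choose φ hφ using this
  have hinj : Function.Injective φ := by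
    intro q q' hq
    have h1 := hφ q
    have h2 := hφ q'
    rw [hq] at h1
    have h3 := K.mul_mem h1 (K.inv_mem h2)
    have h4 : ((q.out : H) : G)⁻¹ * ((q'.out : H) : G) ∈ K := by simpa [mul_assoc] using h3
    rw [← Quotient.out_eq q, ← Quotient.out_eq q']
    apply QuotientGroup.eq.2
    rw [Subgroup.mem_subgroupOf]
    simpa using h4
  have : Finite (H ⧸ K.subgroupOf H) := Finite.of_injective φ hinj
  exact Subgroup.index_ne_zero_of_finite

lemma HFin.of_relIndex {H K : Subgroup G} {X : Set G} (hX : HFin H X) (h : K.relIndex H ≠ 0) :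
    HFin K X := by
  have h1 := hfin_self_of_relIndex h
  obtain ⟨F, hF⟩ := hX
  refine HFin.mono (HFin.biUnion (A := (F : Set G)) F.finite_toSet
    (X := fun f => (· * f) '' (H : Set G)) (fun f _ => h1.rmul f)) (by simpa using hF)

lemma hfin_comm {H K : Subgroup G} (h : Subgroup.Commensurable H K) {X : Set G} :
    HFin H X ↔ HFin K X :=
  ⟨fun hX => hX.of_relIndex h.2, fun hX => hX.of_relIndex h.1⟩

lemma rmul_symmDiff (X Z : Set G) (s : G) :
    (· * s) '' (X ∆ Z) = ((· * s) '' X) ∆ ((· * s) '' Z) :=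
  Set.image_symmDiff (mul_left_injective s) X Z

lemma mem_rmul {X : Set G} {s x : G} : x ∈ (· * s) '' X ↔ x * s⁻¹ ∈ X := by
  constructor
  · rintro ⟨y, hy, rfl⟩; simpa using hy
  · intro h; exact ⟨_, h, by simp⟩

lemma IsAI.mul_mem {H : Subgroup G} {X : Set G} (h : IsAI H X) {g x : G} (hg : g ∈ H) :
    g * x ∈ X ↔ x ∈ X := by
  have h1 := h.1 g hg
  constructor
  · intro hx
    rw [← h1] at hx
    obtain ⟨y, hy, hyx⟩ := hx
    have : y = x := mul_left_cancel hyx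
    rwa [← this]
  · intro hx
    rw [← h1]
    exact ⟨x, hx, rfl⟩

lemma isAI_of {H : Subgroup G} {X : Set G} (h1 : ∀ g ∈ H, ∀ x ∈ X, g * x ∈ X)
    (h2 : ∀ s : G, HFin H (((· * s) '' X) ∆ X)) : IsAI H X := by
  refine ⟨fun h hh => ?_, h2⟩
  apply Set.Subset.antisymm
  · rintro _ ⟨x, hx, rfl⟩; exact h1 h hh x hx
  · intro x hx; exact ⟨h⁻¹ * x, h1 _ (H.inv_mem hh) x hx, by simp⟩

lemma NontrivAI.compl {H : Subgroup G} {X : Set G} (h : NontrivAI H X) : NontrivAI H Xᶜ := by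
  refine ⟨isAI_of (fun g hg x hx => ?_) (fun s => ?_), h.2.2, by rw [compl_compl]; exact h.2.1⟩
  · intro hc; exact hx ((h.1.mul_mem hg).1 hc)
  · refine (h.1.2 s).mono ?_
    intro x hx
    simp only [Set.mem_symmDiff, mem_rmul, Set.mem_compl_iff, not_not] at hx ⊢
    tauto

/-- change of groups for equivalent almost invariant sets, one half -/
lemma comm_half {H K : Subgroup G} {X Z : Set G} (hZ : NontrivAI K Z) (hXZ : HFin K (X ∆ Z))
    (hX : NontrivAI H X) : Subgroup.Commensurable H K := by
  obtain ⟨F, hF⟩ := hfin_iff.1 hXZ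
  have ex : ∀ W : Set G, ¬ HFin K W → ∃ g ∈ W, ∀ f ∈ F, g * f⁻¹ ∉ K := by
    intro W hW
    by_contra hc
    push Not at hc
    exact hW (hfin_iff.2 ⟨F, hc⟩)
  have nm : ∀ g, (∀ f ∈ F, g * f⁻¹ ∉ K) → ∀ k ∈ K, k * g ∉ X ∆ Z := by
    intro g hg k hk hm
    obtain ⟨f, hf, h⟩ := hF _ hm
    apply hg f hf
    have := K.mul_mem (K.inv_mem hk) h
    simpa [mul_assoc] using this
  obtain ⟨g, hgZ, hg⟩ := ex _ hZ.2.1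
  obtain ⟨g', hgZ', hg'⟩ := ex _ hZ.2.2
  have h1 : ∀ k ∈ K, k * g ∈ X := by
    intro k hk
    have := nm g hg k hk
    have h2 := (hZ.1.mul_mem (x := g) hk).2 hgZ
    by_contra hc
    exact this (Or.inr ⟨h2, hc⟩)
  have h1' : ∀ k ∈ K, k * g' ∉ X := by
    intro k hk hc
    have := nm g' hg' k hk
    have h2 := (hZ.compl.1.mul_mem (x := g') hk).2 hgZ'
    exact this (Or.inl ⟨hc, h2⟩)
  have h3 := hX.1.2 (g⁻¹ * g')
  have hmem : ∀ k ∈ K, k * g' ∈ ((· * (g⁻¹ * g')) '' X) ∆ X := by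
    intro k hk
    refine Or.inl ⟨mem_rmul.2 ?_, h1' k hk⟩
    simpa using h1 k hk
  constructor
  · apply relIndex_of_hfin
    have := (h3.mono (X := (· * g') '' (K : Set G))
      (by rintro _ ⟨k, hk, rfl⟩; exact hmem k hk)).rmul g'⁻¹
    refine this.mono ?_
    intro k hk
    exact ⟨k * g', ⟨k, hk, rfl⟩, by simp⟩
  · apply relIndex_of_hfin
    have h4 : HFin K (((· * (g⁻¹ * g')) '' X) ∆ X) := by
      have h5 := hXZ.rmul (g⁻¹ * g')
      rw [rmul_symmDiff] at h5
      refine ((h5.union (hZ.1.2 (g⁻¹ * g'))).union hXZ).mono ?_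
      intro x hx
      simp only [Set.mem_symmDiff, Set.mem_union] at hx ⊢
      tauto
    have h6 : HFin K ((· * g') '' (H : Set G)) := by
      refine h4.mono ?_
      rintro _ ⟨h, hh, rfl⟩
      have := hmem 1 K.one_mem
      rw [one_mul] at this
      simp only [Set.mem_symmDiff, mem_rmul] at this ⊢
      rw [mul_assoc, hX.1.mul_mem hh, hX.1.mul_mem hh]
      exact this
    have h7 := h6.rmul g'⁻¹
    refine h7.mono ?_
    intro k hk
    exact ⟨k * g', ⟨k, hk, rfl⟩, by simp⟩

lemma NontrivAI.of_comm {H K : Subgroup G} {X : Set G} (hX : NontrivAI H X) (hle : K ≤ H)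
    (h : Subgroup.Commensurable H K) : NontrivAI K X := by
  refine ⟨isAI_of (fun g hg x hx => (hX.1.mul_mem (hle hg)).2 hx)
    (fun s => (hfin_comm h).1 (hX.1.2 s)), ?_, ?_⟩
  · rw [← hfin_comm h]; exact hX.2.1
  · rw [← hfin_comm h]; exact hX.2.2

end HF
end SSRN

open scoped Pointwise symmDiff
namespace SSRN
section TreeHF
variable {V : Type*} {T : SimpleGraph V} {G : Type*} [Group G] [MulAction G V]

lemma edge_hfin (f e : Sym2 V) : HFin (edgeStab G e) {g : G | Sym2.map (g • ·) f = e} := by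
  by_cases h : ∃ g : G, Sym2.map (g • ·) f = e
  · obtain ⟨g, hg⟩ := h
    rw [hfin_iff]
    refine ⟨{g}, fun x hx => ⟨g, by simp, ?_⟩⟩
    rw [mem_edgeStab]
    have hx : Sym2.map (x • ·) f = e := hx
    conv_lhs => rw [← hg]
    rw [Sym2.map_map, ← hx]
    congr 1
    funext v
    simp [mul_smul]
  · push Not at h
    refine (HFin.empty _).mono ?_
    intro g hg
    exact absurd hg (h g)

lemma Ctx.hfin_cross {Y : Set (Sym2 V)} (c : Ctx T G) (hY : IsCylinder T G Y) {S : Set V}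
    (hS : IsSpecialForest T S Y) {e : Sym2 V} (he : e ∈ Y) (x y : V) :
    HFin (edgeStab G e) {g : G | ¬ (g • x ∈ S ↔ g • y ∈ S)} := by
  obtain ⟨p, -⟩ := exists_path c.tree x y
  induction p with
  | nil => exact (HFin.empty _).mono (by intro g hg; simp at hg)
  | @cons x z y h q ih =>
    have h1 : HFin (edgeStab G e) (⋃ e' ∈ cobdry T S, {g : G | Sym2.map (g • ·) s(x, z) = e'}) :=
      HFin.biUnion hS.1 fun e' he' =>
        (hfin_comm (cyl_comm hY (hS.2 he') he)).1 (edge_hfin _ e')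
    refine (h1.union ih).mono ?_
    intro g hg
    by_cases hgz : (g • x ∈ S ↔ g • z ∈ S)
    · right
      intro hh
      exact hg (hgz.trans hh)
    · left
      refine Set.mem_iUnion₂.2 ⟨s(g • x, g • z), ?_, by simp⟩
      by_cases hx : g • x ∈ S
      · exact mem_cobdry (c.act g _ _ h) hx (fun hz => hgz ⟨fun _ => hz, fun _ => hx⟩)
      · rw [Sym2.eq_swap]
        refine mem_cobdry (c.act g _ _ h.symm) ?_ hx
        by_contra hz
        exact hgz ⟨fun h => absurd h hx, fun h => absurd h hz⟩

lemma Ctx.hfin_bdd (c : Ctx T G) {e : Sym2 V} (he : e ∈ T.edgeSet) {u : V} (hu : u ∈ e)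
    {X : Set G} (hX : HFin (edgeStab G e) X) (v₀ : V) :
    ∃ R, ∀ g ∈ X, T.dist u (g • v₀) ≤ R := by
  obtain ⟨F, hF⟩ := hfin_iff.1 hX
  refine ⟨F.sup fun f => T.dist u (f • v₀), fun g hg => ?_⟩
  obtain ⟨f, hf, h⟩ := hF g hg
  have h1 := c.stab_fix' he hu h
  have h2 := c.dist_smul (g * f⁻¹) u (f • v₀)
  rw [h1, ← mul_smul, inv_mul_cancel_right] at h2
  rw [h2]
  exact Finset.le_sup (f := fun f => T.dist u (f • v₀)) hf

lemma Ctx.not_hfin (c : Ctx T G) {e : Sym2 V} (he : e ∈ T.edgeSet) {S : Set V}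
    (hS : ¬ S.Finite) (hd : (cobdry T S).Finite) (v₀ : V) : ¬ HFin (edgeStab G e) (XS G v₀ S) := by
  intro hX
  induction e using Sym2.ind with
  | _ u u' =>
    obtain ⟨R, hR⟩ := c.hfin_bdd he (u := u) (by simp) hX v₀
    obtain ⟨a, b, hab, hsub, hu⟩ := exists_ht_subset c.tree hS hd u
    obtain ⟨a', b', hab', hsub', hfar⟩ := ht_far c.tree c.val2 u (R + 1) hab hu
    obtain ⟨g, hg⟩ := c.orbit_ht hab' v₀
    have h1 := hfar _ hg
    have h2 := hR g (hsub (hsub' hg))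
    omega

lemma Ctx.far_elt (c : Ctx T G) (v₀ : V) (n : ℕ) : ∃ s : G, n ≤ T.dist v₀ (s • v₀) := by
  obtain ⟨a, -, -, -, -, -, ha, -, -⟩ := c.val3 v₀
  obtain ⟨a', b', hab', -, hfar⟩ := ht_far c.tree c.val2 v₀ n ha (ht_left c.tree ha)
  obtain ⟨g, hg⟩ := c.orbit_ht hab' v₀
  exact ⟨g, hfar _ hg⟩

lemma Ctx.hfin_trivial (c : Ctx T G) (v₀ : V) {e : Sym2 V} (he : e ∈ T.edgeSet) {X : Set G}
    (hX : HFin (edgeStab G e) X) {H : Subgroup G} (hH : NontrivAI H X) : False := by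
  induction e using Sym2.ind with
  | _ u u' =>
    obtain ⟨R, hR⟩ := c.hfin_bdd he (u := u) (by simp) hX v₀
    obtain ⟨s, hs⟩ := c.far_elt v₀ (2 * R + 1)
    apply hH.2.1
    refine (hH.1.2 s).mono ?_
    intro x hx
    refine Or.inr ⟨hx, fun hx' => ?_⟩
    rw [mem_rmul] at hx'
    have h1 := hR _ hx
    have h2 := hR _ hx'
    have h3 := c.dist_smul (x * s⁻¹) v₀ (s • v₀)
    rw [← mul_smul, inv_mul_cancel_right] at h3
    have h4 := c.tree.connected.dist_triangle (u := (x * s⁻¹) • v₀) (v := u) (w := x • v₀)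
    rw [SimpleGraph.dist_comm (v := u)] at h4
    omega

lemma Ctx.hfin_of_finite (c : Ctx T G) {Y : Set (Sym2 V)} (hY : IsCylinder T G Y) {S : Set V}
    (hS : IsSpecialForest T S Y) {e : Sym2 V} (he : e ∈ Y) (hf : S.Finite) (v₀ : V) :
    HFin (edgeStab G e) (XS G v₀ S) := by
  have hin : ∀ f ∈ T.edgeSet, ∀ w ∈ S, w ∈ f → f ∈ Y := by
    intro f hfe w hw hwf
    by_contra hfY
    obtain ⟨η, hη, hwc⟩ := c.cmp_exists hY w
    have hηS : η ∈ S := Cmp_const hS.2 hw (Cmp_symm hwc)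
    have hb : η ∈ cylBoundary T Y := by
      by_cases h : w = η
      · exact ⟨hη, f, hfe, h ▸ hwf, hfY⟩
      · exact bdry_of_cmp hη hwc h
    exact c.sf_inf_of_bdry hY hS hb hηS hf
  have hfin : {f | f ∈ T.edgeSet ∧ ∃ w ∈ S, w ∈ f}.Finite := by
    refine (hS.1.union ((hf.prod hf).image (fun z => s(z.1, z.2)))).subset ?_
    rintro f ⟨hfe, w, hw, hwf⟩
    obtain ⟨x, rfl⟩ := Sym2.mem_iff_exists.1 hwf
    by_cases hx : x ∈ S
    · exact Or.inr ⟨(w, x), ⟨hw, hx⟩, rfl⟩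
    · exact Or.inl (mem_cobdry hfe hw hx)
  obtain ⟨a, -, -, -, -, -, ha, -, -⟩ := c.val3 v₀
  have h1 : HFin (edgeStab G e)
      (⋃ e' ∈ {f | f ∈ T.edgeSet ∧ ∃ w ∈ S, w ∈ f}, {g : G | Sym2.map (g • ·) s(v₀, a) = e'}) :=
    HFin.biUnion hfin fun e' he' => by
      obtain ⟨h1, w, hw, hwe⟩ := he'
      exact (hfin_comm (cyl_comm hY (hin e' h1 w hw hwe) he)).1 (edge_hfin _ e')
  refine h1.mono ?_
  intro g hg
  exact Set.mem_iUnion₂.2 ⟨s(g • v₀, g • a), ⟨c.act g _ _ ha, g • v₀, hg, by simp⟩, by simp⟩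

lemma exists_common {Y : Set (Sym2 V)} (hY : IsCylinder T G Y) {e : Sym2 V} (he : e ∈ Y)
    {A : Set (Sym2 V)} (hA : A.Finite) (hAY : A ⊆ Y) :
    ∃ K : Subgroup G, Subgroup.Commensurable K (edgeStab G e) ∧ ∀ e' ∈ A, K ≤ edgeStab G e' := by
  induction A, hA using Set.Finite.induction_on with
  | empty => exact ⟨edgeStab G e, Subgroup.Commensurable.refl _, by simp⟩
  | @insert a s _ _ ih =>
    obtain ⟨K, hK, hle⟩ := ih ((Set.subset_insert a s).trans hAY)
    have h1 : Subgroup.Commensurable K (edgeStab G a) :=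
      hK.trans (cyl_comm hY he (hAY (Set.mem_insert a s)))
    refine ⟨K ⊓ edgeStab G a, (comm_inf h1).trans hK, ?_⟩
    rintro e' (rfl | h)
    · exact inf_le_right
    · exact inf_le_left.trans (hle e' h)

lemma Ctx.preserve (c : Ctx T G) {S : Set V} (hne : ∃ e, e ∈ cobdry T S) {g : G}
    (hg : ∀ e ∈ cobdry T S, g ∈ edgeStab G e) (w : V) : g • w ∈ S ↔ w ∈ S := by
  have hD : cobdry T {w | ¬ (g • w ∈ S ↔ w ∈ S)} = ∅ := by
    rw [Set.eq_empty_iff_forall_notMem]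
    rintro _ ⟨he, x, y, rfl, hx, hy⟩
    have he : T.Adj x y := he
    have hfix : s(x, y) ∉ cobdry T S := by
      intro hc
      apply hx
      rw [(c.stab_fix he (hg _ hc)).1]
    have hfix' : s(g • x, g • y) ∉ cobdry T S := by
      intro hc
      apply hfix
      have h1 := (edgeStab G _).inv_mem (hg _ hc)
      rw [mem_edgeStab, Sym2.map_mk] at h1
      simp only [inv_smul_smul] at h1
      rwa [h1]
    have k : ∀ x y, T.Adj x y → s(x, y) ∉ cobdry T S → (x ∈ S ↔ y ∈ S) := by
      intro x y h hn
      by_contra hc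
      by_cases hx : x ∈ S
      · exact hn (mem_cobdry h hx (fun hy => hc ⟨fun _ => hy, fun _ => hx⟩))
      · rw [Sym2.eq_swap] at hn
        by_cases hy : y ∈ S
        · exact hn (mem_cobdry h.symm hy hx)
        · exact hc ⟨fun h => absurd h hx, fun h => absurd h hy⟩
    have k1 := k _ _ he hfix
    have k2 := k _ _ (c.act g _ _ he) hfix'
    simp only [Set.mem_ofPred_eq] at hx hy
    tauto
  rcases cobdry_empty c.tree hD with h | h
  · by_contra hc
    have : w ∈ {w | ¬ (g • w ∈ S ↔ w ∈ S)} := hc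
    rw [h] at this
    exact this
  · obtain ⟨e, he⟩ := hne
    have h2 := hg e he
    obtain ⟨hadj, x, y, rfl, hx, hy⟩ := he
    have : x ∈ {w | ¬ (g • w ∈ S ↔ w ∈ S)} := by rw [h]; trivial
    exact absurd (by rw [(c.stab_fix hadj h2).1]) this

lemma nontriv_cobdry (hT : T.IsTree) {S : Set V} (h : NontrivForest S) : ∃ e, e ∈ cobdry T S := by
  by_contra hc
  rcases cobdry_empty hT (Set.eq_empty_iff_forall_notMem.2 (not_exists.1 hc)) with rfl | rfl
  · exact h.1 Set.finite_empty
  · exact h.2 (by simp)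

lemma XS_compl (v₀ : V) (S : Set V) : XS G v₀ Sᶜ = (XS G v₀ S)ᶜ := rfl

lemma Ctx.xs_nontriv (c : Ctx T G) {Y : Set (Sym2 V)} (hY : IsCylinder T G Y) {S : Set V}
    (hS : IsSpecialForest T S Y) (hn : NontrivForest S) {e : Sym2 V} (he : e ∈ Y) (v₀ : V) :
    ∃ K : Subgroup G, Subgroup.Commensurable K (edgeStab G e) ∧ NontrivAI K (XS G v₀ S) := by
  obtain ⟨K, hK, hle⟩ := exists_common hY he hS.1 hS.2
  refine ⟨K, hK, isAI_of (fun g hg x hx => ?_) (fun s => ?_), ?_, ?_⟩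
  · have := (c.preserve (nontriv_cobdry c.tree hn) (fun e he => hle e he hg) (x • v₀)).2 hx
    rw [← mul_smul] at this
    exact this
  · rw [hfin_comm hK]
    refine (c.hfin_cross hY hS he v₀ (s⁻¹ • v₀)).mono ?_
    intro g hg
    simp only [Set.mem_symmDiff, mem_rmul, XS, Set.mem_ofPred_eq, mul_smul] at hg ⊢
    tauto
  · rw [hfin_comm hK]
    exact c.not_hfin (hY.2.1 he) hn.1 hS.1 v₀
  · rw [hfin_comm hK, ← XS_compl]
    exact c.not_hfin (hY.2.1 he) hn.2 (by rw [cobdry_compl]; exact hS.1) v₀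

lemma symmDiff_mem {F : Set (Set G)} (h1 : ∀ X ∈ F, Xᶜ ∈ F) (h2 : ∀ X ∈ F, ∀ X' ∈ F, X ∩ X' ∈ F)
    {X X' : Set G} (h : X ∈ F) (h' : X' ∈ F) : X ∆ X' ∈ F := by
  have : X ∆ X' = ((X ∩ X'ᶜ)ᶜ ∩ (Xᶜ ∩ X')ᶜ)ᶜ := by
    ext x; simp only [Set.mem_symmDiff, Set.mem_inter_iff, Set.mem_compl_iff]; tauto
  rw [this]
  exact h1 _ (h2 _ (h1 _ (h2 _ h _ (h1 _ h'))) _ (h1 _ (h2 _ (h1 _ h) _ h')))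

lemma Ctx.xs_mem (c : Ctx T G) {Y : Set (Sym2 V)} (hY : IsCylinder T G Y) {S : Set V}
    (hS : IsSpecialForest T S Y) (H : Subgroup G) (v₀ : V) :
    XS G v₀ S ∈ BCT T v₀ Y H := by
  rintro F ⟨f1, f2, f3, -⟩
  have hemp : (∅ : Set G) ∈ F := by
    obtain ⟨e, he⟩ := hY.1
    induction e using Sym2.ind with
    | _ u v =>
      have := f1 u v (hY.2.1 he) he
      have h := f3 _ this _ (f2 _ this)
      rwa [Set.inter_compl_self] at h
  obtain ⟨n, hn⟩ : ∃ n, (cobdry T S).ncard = n := ⟨_, rfl⟩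
  induction n generalizing S with
  | zero =>
    rw [Set.ncard_eq_zero hS.1] at hn
    rcases cobdry_empty c.tree hn with rfl | rfl
    · exact hemp
    · have := f2 _ hemp
      rwa [Set.compl_empty] at this
  | succ n ih =>
    have hne : (cobdry T S).Nonempty := by
      by_contra hc
      rw [Set.not_nonempty_iff_eq_empty] at hc
      rw [hc] at hn
      simp at hn
    obtain ⟨e, he⟩ := hne
    have heY := hS.2 he
    obtain ⟨hadj, u, v, rfl, hu, hv⟩ := id he
    have hadj : T.Adj u v := hadj
    have hsub : cobdry T (S ∆ halfTree T u v) = cobdry T S \ {s(u, v)} := by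
      have hl := ht_left c.tree hadj
      have hr := ht_right (T := T) u v
      have same : ∀ x y, T.Adj x y → s(x, y) ≠ s(u, v) →
          (x ∈ halfTree T u v ↔ y ∈ halfTree T u v) := by
        intro x y h hne
        constructor
        · intro hx
          by_contra hy
          exact hne (cobdry_ht u v (mem_cobdry h hx hy))
        · intro hy
          by_contra hx
          rw [Sym2.eq_swap] at hne
          exact hne (cobdry_ht u v (mem_cobdry h.symm hy hx))
      ext f
      constructor
      · rintro ⟨hf, x, y, rfl, hx, hy⟩
        have hne : s(x, y) ≠ s(u, v) := by
          intro h
          rw [Sym2.eq_iff] at h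
          simp only [Set.mem_symmDiff] at hx hy
          rcases h with ⟨rfl, rfl⟩ | ⟨rfl, rfl⟩ <;> tauto
        have := same x y hf hne
        refine ⟨?_, hne⟩
        simp only [Set.mem_symmDiff] at hx hy
        by_cases hxS : x ∈ S
        · exact mem_cobdry hf hxS (by tauto)
        · rw [Sym2.eq_swap]
          exact mem_cobdry (SimpleGraph.Adj.symm hf) (by tauto) hxS
      · rintro ⟨⟨hf, x, y, rfl, hx, hy⟩, hne⟩
        have := same x y hf hne
        by_cases hxh : x ∈ halfTree T u v
        · rw [Sym2.eq_swap]
          refine mem_cobdry (SimpleGraph.Adj.symm hf) ?_ ?_ <;> simp only [Set.mem_symmDiff] <;> tauto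
        · refine mem_cobdry hf ?_ ?_ <;> simp only [Set.mem_symmDiff] <;> tauto
    have h1 := ih (S := S ∆ halfTree T u v) (sf_symmDiff hS (sf_ht heY)) (by
      rw [hsub, Set.ncard_sdiff_singleton_of_mem he, hn]; rfl)
    have h2 := symmDiff_mem f2 f3 h1 (f1 u v hadj heY)
    have h3 : XS G v₀ (S ∆ halfTree T u v) ∆ Ze T G v₀ u v = XS G v₀ S := by
      have : XS G v₀ (S ∆ halfTree T u v) = XS G v₀ S ∆ Ze T G v₀ u v := rfl
      rw [this, symmDiff_assoc, symmDiff_self, symmDiff_bot]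
    rwa [h3] at h2

lemma Ctx.xs_nontrivB (c : Ctx T G) {Y : Set (Sym2 V)} (hY : IsCylinder T G Y) {S : Set V}
    (hS : IsSpecialForest T S Y) (hn : NontrivForest S) (v₀ : V) :
    XS G v₀ S ∈ NontrivB T G v₀ := by
  obtain ⟨e, he⟩ := hY.1
  obtain ⟨K, -, hK⟩ := c.xs_nontriv hY hS hn he v₀
  exact ⟨⟨Y, hY, e, he, c.xs_mem hY hS _ v₀⟩, K, hK⟩

/-- `X` is represented by the non-trivial special forest `S` based on `Y`. -/
def Rep (T : SimpleGraph V) (G : Type*) [Group G] [MulAction G V] (v₀ : V) (X : Set G)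
    (Y : Set (Sym2 V)) (e : Sym2 V) (S : Set V) : Prop :=
  IsCylinder T G Y ∧ e ∈ Y ∧ IsSpecialForest T S Y ∧ NontrivForest S ∧
    HFin (edgeStab G e) (X ∆ XS G v₀ S)

lemma symmDiff_compl_compl' (X Z : Set G) : Xᶜ ∆ Zᶜ = X ∆ Z := by
  ext x; simp only [Set.mem_symmDiff, Set.mem_compl_iff]; tauto

lemma Ctx.rep (c : Ctx T G) {v₀ : V} {X : Set G} (hX : X ∈ NontrivB T G v₀) :
    ∃ Y e S, Rep T G v₀ X Y e S := by
  obtain ⟨⟨Y, hY, e, he, hB⟩, H, hH⟩ := hX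
  have h := hB {X | ∃ S, IsSpecialForest T S Y ∧ HFin (edgeStab G e) (X ∆ XS G v₀ S)} ⟨?_, ?_, ?_, ?_⟩
  · obtain ⟨S, hS, hXS⟩ := h
    refine ⟨Y, e, S, hY, he, hS, ⟨fun hf => ?_, fun hf => ?_⟩, hXS⟩
    · refine c.hfin_trivial v₀ (hY.2.1 he)
        ((hXS.union (c.hfin_of_finite hY hS he hf v₀)).mono ?_) hH
      intro x hx
      simp only [Set.mem_symmDiff, Set.mem_union]; tauto
    · refine c.hfin_trivial v₀ (hY.2.1 he)
        ((hXS.union (c.hfin_of_finite hY (sf_compl hS) he hf v₀)).mono ?_) hH.compl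
      intro x hx
      simp only [Set.mem_symmDiff, Set.mem_union, XS_compl, Set.mem_compl_iff] at hx ⊢; tauto
  · intro u v _ huv
    refine ⟨halfTree T u v, sf_ht huv, ?_⟩
    have : Ze T G v₀ u v ∆ XS G v₀ (halfTree T u v) = ∅ := symmDiff_self _
    rw [this]
    exact HFin.empty _
  · rintro X ⟨S, hS, h⟩
    refine ⟨Sᶜ, sf_compl hS, ?_⟩
    rwa [XS_compl, symmDiff_compl_compl']
  · rintro X ⟨S, hS, h⟩ X' ⟨S', hS', h'⟩
    refine ⟨S ∩ S', sf_inter hS hS', (h.union h').mono ?_⟩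
    intro x
    have : XS G v₀ (S ∩ S') = XS G v₀ S ∩ XS G v₀ S' := rfl
    simp only [this, Set.mem_symmDiff, Set.mem_union, Set.mem_inter_iff]; tauto
  · rintro X ⟨S, hS, h⟩ X' h'
    refine ⟨S, hS, (h.union h').mono ?_⟩
    intro x
    simp only [Set.mem_symmDiff, Set.mem_union]; tauto

lemma Rep.compl {v₀ : V} {X : Set G} {Y e S} (h : Rep T G v₀ X Y e S) :
    Rep T G v₀ Xᶜ Y e Sᶜ := by
  obtain ⟨h1, h2, h3, h4, h5⟩ := h
  refine ⟨h1, h2, sf_compl h3, ⟨h4.2, by rw [compl_compl]; exact h4.1⟩, ?_⟩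
  rwa [XS_compl, symmDiff_compl_compl']

lemma Ctx.rep_comm (c : Ctx T G) {v₀ : V} {X : Set G} {Y e S} (h : Rep T G v₀ X Y e S)
    {H : Subgroup G} (hH : NontrivAI H X) : Subgroup.Commensurable H (edgeStab G e) := by
  obtain ⟨h1, h2, h3, h4, h5⟩ := h
  obtain ⟨K, hK, hKX⟩ := c.xs_nontriv h1 h3 h4 h2 v₀
  exact (comm_half hKX ((hfin_comm hK).2 h5) hH).trans hK

lemma Ctx.corner (c : Ctx T G) {v₀ : V} {X X' : Set G} {Y e S Y' e' S'}
    (h : Rep T G v₀ X Y e S) (h' : Rep T G v₀ X' Y' e' S') (hne : Y ≠ Y')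
    (h1 : ∀ y ∈ cylVerts Y', y ∉ S) (h2 : ∀ y ∈ cylVerts Y, y ∉ S') :
    HFin (edgeStab G e) (X ∩ X') := by
  obtain ⟨hY, he, hS, hn, hX⟩ := h
  obtain ⟨hY', he', hS', hn', hX'⟩ := h'
  have hdisj : ∀ w ∈ S, w ∉ S' := by
    intro w hw hw'
    -- cross from `w` to a vertex of `Y'`
    obtain ⟨f, hf⟩ := hY'.1
    obtain ⟨y, hy⟩ : ∃ y, y ∈ f := ⟨_, Sym2.out_fst_mem f⟩
    have hyS := h1 y ⟨f, hf, hy⟩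
    obtain ⟨ζ, hζ, hwζ⟩ := c.cmp_exists hY w
    have hζS : ζ ∈ S := Cmp_const hS.2 hw (Cmp_symm hwζ)
    obtain ⟨ζ', hζ', hwζ'⟩ := c.cmp_exists hY' w
    have hζS' : ζ' ∈ S' := Cmp_const hS'.2 hw' (Cmp_symm hwζ')
    -- path from w to ζ crosses δS', so contains a vertex of Y'
    obtain ⟨p, hp, hpY⟩ := Cmp_path (Cmp_symm hwζ)
    have hp' : ∀ x ∈ p.support, x ∈ S := fun x hx =>
      Cmp_const hS.2 hw (Cmp_support p hpY hx)
    obtain ⟨x, d, h3, h4, h5, h6⟩ := walk_cross p hw' (h2 ζ hζ)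
    exact h1 x ⟨_, hS'.2 (mem_cobdry h3 h4 h5), by simp⟩
      (hp' x (p.fst_mem_support_of_mem_edges h6))
  obtain ⟨F, hF⟩ := hfin_iff.1 hX'
  obtain ⟨y, hy⟩ : ∃ y, y ∈ e' := ⟨_, Sym2.out_fst_mem e'⟩
  have hyS := h1 y ⟨e', he', hy⟩
  have h3 : HFin (edgeStab G e)
      (⋃ f ∈ (F : Set G), {g : G | ¬ (g • (f⁻¹ • y) ∈ S ↔ g • v₀ ∈ S)}) :=
    HFin.biUnion F.finite_toSet fun f _ => c.hfin_cross hY hS he _ _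
  refine (hX.union h3).mono ?_
  rintro x ⟨hx, hx'⟩
  by_cases hxS : x ∈ XS G v₀ S
  · right
    have hxS' : x ∉ XS G v₀ S' := hdisj _ hxS
    obtain ⟨f, hf, hh⟩ := hF x (Or.inl ⟨hx', hxS'⟩)
    refine Set.mem_iUnion₂.2 ⟨f, hf, ?_⟩
    have h4 := c.stab_fix' (hY'.2.1 he') hy hh
    rw [mul_smul] at h4
    simp only [Set.mem_ofPred_eq, h4]
    intro hc
    exact hyS (hc.2 hxS)
  · exact Or.inl (Or.inl ⟨hx, hxS⟩)

lemma Ctx.cross_same (c : Ctx T G) {v₀ : V} {X X' : Set G} {Y e S Y' e' S'}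
    (h : Rep T G v₀ X Y e S) (h' : Rep T G v₀ X' Y' e' S')
    (hc : Crosses (edgeStab G e) X X') : Y = Y' := by
  by_contra hne
  have side : ∀ {Y Y' : Set (Sym2 V)} {S : Set V}, IsCylinder T G Y → IsCylinder T G Y' → Y ≠ Y' →
      IsSpecialForest T S Y → (∀ y ∈ cylVerts Y', y ∉ S) ∨ (∀ y ∈ cylVerts Y', y ∉ Sᶜ) := by
    intro Y Y' S hY hY' hne hS
    by_cases hx : ∃ y ∈ cylVerts Y', y ∈ S
    · obtain ⟨y, hy, hyS⟩ := hx
      right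
      intro z hz hzS
      exact hzS (c.cyl_const hY' hY hne hS hy hz hyS)
    · left
      push Not at hx
      exact hx
  rcases side h.1 h'.1 hne h.2.2.1 with h1 | h1 <;>
  rcases side h'.1 h.1 (Ne.symm hne) h'.2.2.1 with h2 | h2
  · exact hc.1 (c.corner h h' hne h1 h2)
  · exact hc.2.1 (c.corner h h'.compl hne h1 h2)
  · exact hc.2.2.1 (c.corner h.compl h' hne h1 h2)
  · exact hc.2.2.2 (c.corner h.compl h'.compl hne h1 h2)

lemma Ctx.step_comm (c : Ctx T G) {v₀ : V} {X X' : Set G} (h : ccStep T G v₀ X X')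
    {H K : Subgroup G} (hH : NontrivAI H X) (hK : NontrivAI K X') :
    Subgroup.Commensurable H K := by
  obtain ⟨hX, hX', h⟩ := h
  obtain ⟨Y, e, S, hr⟩ := c.rep hX
  obtain ⟨Y', e', S', hr'⟩ := c.rep hX'
  have h1 := c.rep_comm hr hH
  rcases h with ⟨H', K', hH', hK', hc⟩ | ⟨H', hH', hs⟩
  · have h2 := c.rep_comm hr hH'
    have hc' : Crosses (edgeStab G e) X X' := by
      unfold Crosses at hc ⊢
      simpa only [hfin_comm h2] using hc
    have := c.cross_same hr hr' hc'
    subst this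
    exact h1.trans ((cyl_comm hr.1 hr.2.1 hr'.2.1).trans (c.rep_comm hr' hK).symm)
  · have h2 := c.rep_comm hr hH'
    have h3 : Subgroup.Commensurable K H' := by
      rcases hs with hs | hs
      · exact comm_half hH' (by rwa [symmDiff_comm]) hK
      · exact comm_half hH' (by rwa [symmDiff_comm]) hK.compl
    exact h1.trans (h2.symm.trans h3.symm)

lemma Ctx.rel_comm (c : Ctx T G) {v₀ : V} {X X' : Set G} (h : ccRel T G v₀ X X') :
    (X ∈ NontrivB T G v₀ ↔ X' ∈ NontrivB T G v₀) ∧ (X ∈ NontrivB T G v₀ →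
      ∀ H K : Subgroup G, NontrivAI H X → NontrivAI K X' → Subgroup.Commensurable H K) := by
  induction h with
  | rel x y h => exact ⟨⟨fun _ => h.2.1, fun _ => h.1⟩, fun _ H K hH hK => c.step_comm h hH hK⟩
  | refl x =>
    refine ⟨Iff.rfl, fun hx H K hH hK => ?_⟩
    obtain ⟨Y, e, S, hr⟩ := c.rep hx
    exact (c.rep_comm hr hH).trans (c.rep_comm hr hK).symm
  | symm x y _ ih => exact ⟨ih.1.symm, fun hy H K hH hK => (ih.2 (ih.1.2 hy) K H hK hH).symm⟩
  | trans x y z _ _ ih1 ih2 =>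
    refine ⟨ih1.1.trans ih2.1, fun hx H K hH hK => ?_⟩
    obtain ⟨-, L, hL⟩ := ih1.1.1 hx
    exact (ih1.2 hx H L hH hL).trans (ih2.2 (ih1.1.1 hx) L K hL hK)

lemma ccOf_eq {v₀ : V} {X X' : Set G} (h : ccRel T G v₀ X X') : ccOf T G v₀ X = ccOf T G v₀ X' := by
  ext Z
  exact ⟨fun hz => Relation.EqvGen.trans _ _ _ (Relation.EqvGen.symm _ _ h) hz,
    fun hz => Relation.EqvGen.trans _ _ _ h hz⟩

lemma mem_ccOf_self {v₀ : V} (X : Set G) : X ∈ ccOf T G v₀ X := Relation.EqvGen.refl _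

end TreeHF
end SSRN

open scoped Pointwise symmDiff
namespace SSRN
section Main
variable {V : Type*} {T : SimpleGraph V} {G : Type*} [Group G] [MulAction G V]

lemma Ctx.cyl_of_comm (c : Ctx T G) {v₀ : V} {Y YS : Set (Sym2 V)} {S : Set V}
    (hY : IsCylinder T G Y) (hYS : IsCylinder T G YS) (hS : IsSpecialForest T S YS)
    (hn : NontrivForest S) (h : CCCBasedOn G Y (ccOf T G v₀ (XS G v₀ S))) : YS = Y := by
  obtain ⟨X, hX, H, ⟨e, he, hHe⟩, hH⟩ := h
  obtain ⟨f, hf⟩ := hYS.1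
  obtain ⟨K, hK, hKS⟩ := c.xs_nontriv hYS hS hn hf v₀
  have h1 := (c.rel_comm hX).2 (c.xs_nontrivB hYS hS hn v₀) K H hKS hH
  exact cyl_eq hYS hY hf he (hK.symm.trans (h1.trans hHe))

lemma Ctx.rel_of_equiv (c : Ctx T G) (v₀ : V) {Y : Set (Sym2 V)} (hY : IsCylinder T G Y)
    {S P : Set V} (hS : IsSpecialForest T S Y) (hP : IsSpecialForest T P Y)
    (hn : NontrivForest S) (h : (S ∆ P).Finite) : ccRel T G v₀ (XS G v₀ S) (XS G v₀ P) := by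
  obtain ⟨e, he⟩ := hY.1
  obtain ⟨K, hK, hKS⟩ := c.xs_nontriv hY hS hn he v₀
  have hnP : NontrivForest P := by
    refine ⟨fun hf => hn.1 ((h.union hf).subset ?_), fun hf => hn.2 ((h.union hf).subset ?_)⟩
    · intro x hx
      simp only [Set.mem_union, Set.mem_symmDiff]; tauto
    · intro x hx
      simp only [Set.mem_union, Set.mem_symmDiff, Set.mem_compl_iff] at hx ⊢; tauto
  refine Relation.EqvGen.rel _ _ ⟨c.xs_nontrivB hY hS hn v₀, c.xs_nontrivB hY hP hnP v₀,
    Or.inr ⟨K, hKS, Or.inl ?_⟩⟩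
  rw [hfin_comm hK]
  exact c.hfin_of_finite hY (sf_symmDiff hS hP) he h v₀

lemma Ctx.rel_compl (c : Ctx T G) (v₀ : V) {Y : Set (Sym2 V)} (hY : IsCylinder T G Y)
    {S : Set V} (hS : IsSpecialForest T S Y)
    (hn : NontrivForest S) : ccRel T G v₀ (XS G v₀ S) (XS G v₀ Sᶜ) := by
  obtain ⟨e, he⟩ := hY.1
  obtain ⟨K, hK, hKS⟩ := c.xs_nontriv hY hS hn he v₀
  refine Relation.EqvGen.rel _ _ ⟨c.xs_nontrivB hY hS hn v₀,
    c.xs_nontrivB hY (sf_compl hS) ⟨hn.2, by rw [compl_compl]; exact hn.1⟩ v₀,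
    Or.inr ⟨K, hKS, Or.inr ?_⟩⟩
  rw [XS_compl, compl_compl, symmDiff_self]
  exact HFin.empty _

lemma Ctx.rel_of_cross (c : Ctx T G) (v₀ : V) {Y : Set (Sym2 V)} (hY : IsCylinder T G Y)
    {S P : Set V} (hS : IsSpecialForest T S Y) (hP : IsSpecialForest T P Y)
    (h1 : ∃ v ∈ cylBoundary T Y, v ∈ S ∩ P) (h2 : ∃ v ∈ cylBoundary T Y, v ∈ S ∩ Pᶜ)
    (h3 : ∃ v ∈ cylBoundary T Y, v ∈ Sᶜ ∩ P) (h4 : ∃ v ∈ cylBoundary T Y, v ∈ Sᶜ ∩ Pᶜ) :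
    ccRel T G v₀ (XS G v₀ S) (XS G v₀ P) := by
  obtain ⟨e, he⟩ := hY.1
  have inf : ∀ {D : Set V}, IsSpecialForest T D Y → (∃ v ∈ cylBoundary T Y, v ∈ D) → ¬ D.Finite :=
    fun hD ⟨v, hv, hvD⟩ => c.sf_inf_of_bdry hY hD hv hvD
  have i1 := inf (sf_inter hS hP) h1
  have i2 := inf (sf_inter hS (sf_compl hP)) h2
  have i3 := inf (sf_inter (sf_compl hS) hP) h3
  have i4 := inf (sf_inter (sf_compl hS) (sf_compl hP)) h4
  have hn : NontrivForest S := ⟨fun h => i1 (h.subset Set.inter_subset_left),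
    fun h => i3 (h.subset Set.inter_subset_left)⟩
  have hnP : NontrivForest P := ⟨fun h => i1 (h.subset Set.inter_subset_right),
    fun h => i2 (h.subset Set.inter_subset_right)⟩
  obtain ⟨K, hK, hKS⟩ := c.xs_nontriv hY hS hn he v₀
  obtain ⟨K', hK', hKP⟩ := c.xs_nontriv hY hP hnP he v₀
  refine Relation.EqvGen.rel _ _ ⟨c.xs_nontrivB hY hS hn v₀, c.xs_nontrivB hY hP hnP v₀,
    Or.inl ⟨K, K', hKS, hKP, ?_, ?_, ?_, ?_⟩⟩ <;> rw [hfin_comm hK]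
  · exact c.not_hfin (hY.2.1 he) i1 (sf_inter hS hP).1 v₀
  · exact c.not_hfin (hY.2.1 he) i2 (sf_inter hS (sf_compl hP)).1 v₀
  · exact c.not_hfin (hY.2.1 he) i3 (sf_inter (sf_compl hS) hP).1 v₀
  · exact c.not_hfin (hY.2.1 he) i4 (sf_inter (sf_compl hS) (sf_compl hP)).1 v₀

lemma Ctx.split (c : Ctx T G) {Y : Set (Sym2 V)} (hY : IsCylinder T G Y) {v w : V}
    (hv : v ∈ cylVerts Y) (hw : w ∈ cylVerts Y) (hne : v ≠ w) :
    ∃ D, IsSpecialForest T D Y ∧ v ∉ D ∧ w ∈ D := by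
  obtain ⟨p, hp⟩ := exists_path c.tree v w
  have h := c.cyl_convex hY hv hw hp
  cases p with
  | nil => exact absurd rfl hne
  | @cons _ x _ hadj q =>
    refine ⟨halfTree T v x, sf_ht (h s(v, x) (by simp)), ht_left c.tree hadj, q, ?_, ?_⟩
    · exact hp.of_cons
    · intro hm
      have h1 := q.fst_mem_support_of_mem_edges hm
      rw [SimpleGraph.Walk.cons_isPath_iff] at hp
      exact hp.2 h1

lemma Ctx.single (c : Ctx T G) (v₀ : V) {Y : Set (Sym2 V)} (hY : IsCylinder T G Y)
    {S S' : Set V} (hS : IsSpecialForest T S Y) (hS' : IsSpecialForest T S' Y)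
    (hn : NontrivForest S) (hn' : NontrivForest S') (hsub : S' ⊆ S)
    (hCnp : ¬ PeripheralCCC T G v₀ (ccOf T G v₀ (XS G v₀ S)))
    (hne : ccOf T G v₀ (XS G v₀ S') ≠ ccOf T G v₀ (XS G v₀ S)) :
    ∃ v ∈ cylBoundary T Y, v ∈ S' ∧ ∀ w ∈ cylBoundary T Y, w ∈ S' → w = v := by
  obtain ⟨v, hv, hvS⟩ := c.bdry_of_sf_inf hY hS' hn'.1
  refine ⟨v, hv, hvS, ?_⟩
  by_contra hc
  push Not at hc
  obtain ⟨w, hw, hwS, hwv⟩ := hc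
  obtain ⟨a, ha, haS⟩ := c.bdry_of_sf_inf hY (sf_compl hS) hn.2
  by_cases hb : ∀ b ∈ cylBoundary T Y, b ∈ Sᶜ → b = a
  · obtain ⟨hfv, hfin⟩ := c.peri_of_single hY (sf_compl hS) ha haS hb
    refine hCnp ⟨Y, a, hY, ha, hfv, ?_⟩
    refine Relation.EqvGen.trans _ _ _ (c.rel_compl v₀ hY hS hn) ?_
    exact c.rel_of_equiv v₀ hY (sf_compl hS) (c.sf_peri hY ha.1 hfv)
      ⟨hn.2, by rw [compl_compl]; exact hn.1⟩ hfin
  · push Not at hb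
    obtain ⟨b, hb, hbS, hba⟩ := hb
    obtain ⟨D1, hD1, hv1, hw1⟩ := c.split hY hv.1 hw.1 (Ne.symm hwv)
    obtain ⟨D2, hD2, ha2, hb2⟩ := c.split hY ha.1 hb.1 (Ne.symm hba)
    have hP : IsSpecialForest T ((S' ∩ D1) ∪ (Sᶜ ∩ D2)) Y :=
      sf_union (sf_inter hS' hD1) (sf_inter (sf_compl hS) hD2)
    have hvS1 := hsub hvS
    have hwS1 := hsub hwS
    have haS1 : a ∉ S' := fun h => haS (hsub h)
    have hbS1 : b ∉ S' := fun h => hbS (hsub h)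
    rw [Set.mem_compl_iff] at haS hbS
    apply hne
    have r1 := c.rel_of_cross v₀ hY hS' hP
      ⟨w, hw, by simp only [Set.mem_inter_iff, Set.mem_union, Set.mem_compl_iff]; tauto⟩
      ⟨v, hv, by simp only [Set.mem_inter_iff, Set.mem_union, Set.mem_compl_iff]; tauto⟩
      ⟨b, hb, by simp only [Set.mem_inter_iff, Set.mem_union, Set.mem_compl_iff]; tauto⟩
      ⟨a, ha, by simp only [Set.mem_inter_iff, Set.mem_union, Set.mem_compl_iff]; tauto⟩
    have r2 := c.rel_of_cross v₀ hY hS hP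
      ⟨w, hw, by simp only [Set.mem_inter_iff, Set.mem_union, Set.mem_compl_iff]; tauto⟩
      ⟨v, hv, by simp only [Set.mem_inter_iff, Set.mem_union, Set.mem_compl_iff]; tauto⟩
      ⟨b, hb, by simp only [Set.mem_inter_iff, Set.mem_union, Set.mem_compl_iff]; tauto⟩
      ⟨a, ha, by simp only [Set.mem_inter_iff, Set.mem_union, Set.mem_compl_iff]; tauto⟩
    exact (ccOf_eq r1).trans (ccOf_eq r2).symm

/-- Connected in the subdivided tree of cylinders avoiding `Y_c`. -/
def Rch (T : SimpleGraph V) (G : Type*) [Group G] [MulAction G V] (Y : Set (Sym2 V))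
    (x y : TcSubV V) : Prop := ∃ p : (TcSub T G).Walk x y, tcY Y ∉ p.support

lemma Rch.trans {Y : Set (Sym2 V)} {x y z : TcSubV V} (h : Rch T G Y x y) (h' : Rch T G Y y z) :
    Rch T G Y x z := by
  obtain ⟨p, hp⟩ := h
  obtain ⟨q, hq⟩ := h'
  refine ⟨p.append q, ?_⟩
  rw [SimpleGraph.Walk.mem_support_append_iff]
  tauto

lemma Rch.symm {Y : Set (Sym2 V)} {x y : TcSubV V} (h : Rch T G Y x y) : Rch T G Y y x := by
  obtain ⟨p, hp⟩ := h
  exact ⟨p.reverse, by simpa using hp⟩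

lemma Rch.refl {Y : Set (Sym2 V)} {x : TcSubV V} (h : tcY Y ≠ x) : Rch T G Y x x :=
  ⟨.nil, by simpa using h⟩

lemma tcv_ne_mid (v w : V) (Z : Set (Sym2 V)) : tcv v ≠ tcMid w Z := fun h => by
  injection h

lemma tcY_ne_mid (w : V) (Y Z : Set (Sym2 V)) : tcY Y ≠ tcMid w Z := fun h => by
  injection h with h
  injection h

lemma tcY_ne_v (w : V) (Y : Set (Sym2 V)) : tcY Y ≠ tcv w := fun h => by
  injection h

lemma tcY_ne {Y Z : Set (Sym2 V)} (hne : Z ≠ Y) : tcY Y ≠ tcY Z := fun h => by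
  injection h with h
  injection h with h
  exact hne h.symm

lemma rch_adj {Y : Set (Sym2 V)} {x y : TcSubV V} (h : (TcSub T G).Adj x y) (hx : tcY Y ≠ x)
    (hy : tcY Y ≠ y) : Rch T G Y x y := by
  refine ⟨.cons h .nil, ?_⟩
  rw [SimpleGraph.Walk.support_cons, SimpleGraph.Walk.support_nil, List.mem_cons,
    List.mem_singleton]
  tauto

lemma rch_mid {Y Z : Set (Sym2 V)} {v : V} (h : MidOK T G v Z) : Rch T G Y (tcv v) (tcMid v Z) :=
  rch_adj ⟨tcv_ne_mid _ _ _, Or.inl (Or.inl ⟨v, Z, h, rfl, rfl⟩)⟩ (tcY_ne_v _ _) (tcY_ne_mid _ _ _)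

lemma rch_cyl {Y Z : Set (Sym2 V)} {v : V} (hne : Z ≠ Y) (h : MidOK T G v Z) :
    Rch T G Y (tcY Z) (tcMid v Z) :=
  rch_adj ⟨tcY_ne_mid _ _ _, Or.inl (Or.inr ⟨v, Z, h, rfl, rfl⟩)⟩ (tcY_ne hne) (tcY_ne_mid _ _ _)

lemma rch_step {Y Z Z' : Set (Sym2 V)} (hZ : IsCylinder T G Z) (hZ' : IsCylinder T G Z')
    (h : Z ≠ Y) (h' : Z' ≠ Y) {u : V} (hu : u ∈ cylVerts Z) (hu' : u ∈ cylVerts Z') :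
    Rch T G Y (tcY Z) (tcY Z') := by
  by_cases hne : Z = Z'
  · subst hne
    exact Rch.refl (tcY_ne h)
  · have m1 : MidOK T G u Z := ⟨hZ, bdry_of_two hZ hZ' hne hu hu'⟩
    have m2 : MidOK T G u Z' := ⟨hZ', bdry_of_two hZ' hZ (Ne.symm hne) hu' hu⟩
    exact (((rch_cyl h m1).trans (rch_mid m1).symm).trans (rch_mid m2)).trans (rch_cyl h' m2).symm

lemma rch_walk {Y : Set (Sym2 V)} (hY : IsCylinder T G Y) {u w : V} (p : T.Walk u w)
    (hp : ∀ e ∈ p.edges, e ∉ Y) {Z Z' : Set (Sym2 V)} (hZ : IsCylinder T G Z)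
    (hZ' : IsCylinder T G Z') (h : Z ≠ Y) (h' : Z' ≠ Y) (hu : u ∈ cylVerts Z)
    (hw : w ∈ cylVerts Z') : Rch T G Y (tcY Z) (tcY Z') := by
  induction p generalizing Z with
  | nil => exact rch_step hZ hZ' h h' hu hw
  | @cons u x w hadj q ih =>
    obtain ⟨Z1, hZ1, he⟩ := cyl_exists (G := G) (e := s(u, x)) (T := T) hadj
    have hne : Z1 ≠ Y := fun hh => hp s(u, x) (by simp) (hh ▸ he)
    exact (rch_step hZ hZ1 h hne hu ⟨_, he, by simp⟩).trans
      (ih (fun e he => hp e (by simp [he])) hZ1 hne ⟨_, he, by simp⟩ hw)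

lemma Ctx.second_bdry (c : Ctx T G) {Y : Set (Sym2 V)} (hY : IsCylinder T G Y) {v : V}
    (hv : v ∈ cylBoundary T Y) : ∃ w ∈ cylBoundary T Y, w ≠ v := by
  obtain ⟨⟨e, he, hve⟩, -⟩ := hv
  obtain ⟨x, rfl⟩ := Sym2.mem_iff_exists.1 hve
  have hadj : T.Adj v x := hY.2.1 he
  obtain ⟨w, hw, hwD⟩ := c.bdry_of_sf_inf hY (sf_ht he) (ht_infinite c.tree c.val2 hadj)
  exact ⟨w, hw, fun h => ht_left c.tree hadj (h ▸ hwD)⟩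

lemma Ctx.phi_rch (c : Ctx T G) (v₀ : V) {Y Y' : Set (Sym2 V)} (hY' : IsCylinder T G Y')
    (hne : Y' ≠ Y) {S' : Set V} (hS' : IsSpecialForest T S' Y') (hn' : NontrivForest S')
    {Φ : Set (Set G) → TcSubV V} (hΦ : PhiSpec T G v₀ Φ) :
    Rch T G Y (tcY Y') (Φ (ccOf T G v₀ (XS G v₀ S'))) := by
  obtain ⟨e, he⟩ := hY'.1
  obtain ⟨K, hK, hKS⟩ := c.xs_nontriv hY' hS' hn' he v₀
  have hB := c.xs_nontrivB hY' hS' hn' v₀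
  by_cases hper : PeripheralCCC T G v₀ (ccOf T G v₀ (XS G v₀ S'))
  · obtain ⟨Z, v, hZ, hv, hfv, hX⟩ := hper
    have hrel : ccRel T G v₀ (XS G v₀ S') (XvY T G v₀ Z v) := hX
    obtain ⟨r1, r2⟩ := c.rel_comm hrel
    obtain ⟨-, H, hH⟩ := r1.1 hB
    obtain ⟨f, hf⟩ := hZ.1
    have hsp := c.sf_peri hZ hv.1 hfv
    have hnP : NontrivForest (periForest T Z v) := by
      constructor
      · refine c.sf_inf_of_bdry hZ hsp hv ?_
        rw [c.peri_eq hZ hv.1]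
        exact Cmp_refl v
      · intro hfin
        exact c.hfin_trivial v₀ (hZ.2.1 hf) (c.hfin_of_finite hZ (sf_compl hsp) hf hfin v₀) hH.compl
    obtain ⟨L, hL, hLX⟩ := c.xs_nontriv hZ hsp hnP hf v₀
    have hKL := r2 hB K L hKS hLX
    have hZY : Z = Y' := cyl_eq hZ hY' hf he (hL.symm.trans (hKL.symm.trans hK))
    subst hZY
    rw [ccOf_eq hrel]
    obtain ⟨w, hw, hwv⟩ := c.second_bdry hZ hv
    by_cases h3 : ∃ a ∈ cylBoundary T Z, a ≠ v ∧ a ≠ w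
    · obtain ⟨a, ha, hav, haw⟩ := h3
      rw [hΦ.2.1 Z v hZ hv hfv ⟨v, w, a, hv, hw, ha, hwv.symm, hav.symm, haw.symm⟩]
      exact rch_cyl hne ⟨hZ, hv⟩
    · rw [hΦ.2.2 Z v hZ hv hfv ⟨v, w, hwv.symm, ?_⟩]
      · exact Rch.refl (tcY_ne hne)
      · push Not at h3
        ext a
        simp only [Set.mem_insert_iff, Set.mem_singleton_iff]
        constructor
        · intro ha
          by_cases hav : a = v
          · exact Or.inl hav
          · exact Or.inr (h3 a ha hav)
        · rintro (rfl | rfl)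
          · exact hv
          · exact hw
  · rw [hΦ.1 _ Y' ⟨_, hB, rfl⟩ hY' ⟨_, mem_ccOf_self _, K, ⟨e, he, hK⟩, hKS⟩ hper]
    exact Rch.refl (tcY_ne hne)

end Main
end SSRN

open scoped Pointwise symmDiff
namespace SSRN

/-- Lemma 3.7. Let `Y` be a cylinder with `|∂Y| ≥ 4`, let `S, S'` be
non-trivial special forests with `S' ⊆ S`, `[[S]] = C_Y` non-peripheral based on `Y` and
`[[S']] ≠ C_Y`. Then `η = η_Y(S') ∈ Y` is defined, `η ∈ S`, `S'` contains an equivalent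
subforest `S''` with `S'' ⊆ pr_Y⁻¹({η}) ⊆ S`; moreover `Φ([[S']])` lies in the component
of `T_c ∖ {Y_c}` containing `η_c`. -/
theorem stmt_14 {G V : Type*} [Group G] [MulAction G V]
    (hGfg : Group.FG G)
    (T : SimpleGraph V) (hT : T.IsTree) (hact : ActsOn T G) (hinv : NoInversions T G)
    (E : Set (Subgroup G)) (hE : Admissible E) (hET : IsETree T G E)
    (hmin : MinimalAction T G) (v₀ : V)
    (hmany : ∃ Y₁ Y₂ : Set (Sym2 V), IsCylinder T G Y₁ ∧ IsCylinder T G Y₂ ∧ Y₁ ≠ Y₂)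
    (hval3 : ∀ w : V, ∃ a b c : V, a ≠ b ∧ a ≠ c ∧ b ≠ c ∧ T.Adj w a ∧ T.Adj w b ∧ T.Adj w c)
    (Y : Set (Sym2 V)) (hY : IsCylinder T G Y)
    (hbig4 : ∃ s : Finset V, s.card = 4 ∧ ↑s ⊆ cylBoundary T Y)
    (S S' : Set V) (YS YS' : Set (Sym2 V))
    (hYS : IsCylinder T G YS) (hYS' : IsCylinder T G YS')
    (hS : IsSpecialForest T S YS) (hS' : IsSpecialForest T S' YS')
    (hSnt : NontrivForest S) (hS'nt : NontrivForest S')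
    (hsub : S' ⊆ S)
    (hCY : CCCBasedOn G Y (ccOf T G v₀ (XS G v₀ S)))
    (hCnp : ¬ PeripheralCCC T G v₀ (ccOf T G v₀ (XS G v₀ S)))
    (hCin : XS G v₀ S ∈ NontrivB T G v₀)
    (hne : ccOf T G v₀ (XS G v₀ S') ≠ ccOf T G v₀ (XS G v₀ S)) :
    ∃ η : V,
      -- `η = η_Y(S')` is defined
      ((∃ Y' : Set (Sym2 V), IsCylinder T G Y' ∧ Y' ≠ Y ∧ IsSpecialForest T S' Y' ∧
          ∀ w ∈ cylVerts Y', projIs T (cylVerts Y) w η) ∨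
        (∃ v : V, v ∈ cylBoundary T Y ∧ FiniteValenceIn Y v ∧
          (S' ∆ periForest T Y v).Finite ∧ η = v)) ∧
      η ∈ cylVerts Y ∧ η ∈ S ∧
      -- `S'` contains an equivalent subforest `S'' ⊆ pr_Y⁻¹({η}) ⊆ S`
      (∃ S'' : Set V, S'' ⊆ S' ∧ (S' ∆ S'').Finite ∧
        S'' ⊆ {w : V | projIs T (cylVerts Y) w η} ∧
        {w : V | projIs T (cylVerts Y) w η} ⊆ S) ∧
      -- moreover, `Φ([[S']])` lies in the component of `T_c ∖ {Y_c}` containing `η_c`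
      (∀ Φ : Set (Set G) → TcSubV V, PhiSpec T G v₀ Φ →
        ∃ p : (TcSub T G).Walk (tcv η) (Φ (ccOf T G v₀ (XS G v₀ S'))),
          tcY Y ∉ p.support) := by
  have c : Ctx T G := ⟨hT, hact, hinv, ⟨E, hE, hET⟩, hmin, hval3, hmany⟩
  have hYY := c.cyl_of_comm hY hYS hS hSnt hCY
  subst hYY
  by_cases hYe : YS' = YS
  · subst hYe
    obtain ⟨v, hv, hvS, huniq⟩ := c.single v₀ hY hS hS' hSnt hS'nt hsub hCnp hne
    obtain ⟨hfv, hfin⟩ := c.peri_of_single hY hS' hv hvS huniq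
    have hpe := c.peri_eq hY hv.1
    have hfib : {w : V | projIs T (cylVerts YS') w v} = Cmp T YS' v := by
      ext w; exact c.proj_iff hY hv.1
    refine ⟨v, Or.inr ⟨v, hv, hfv, hfin, rfl⟩, hv.1, hsub hvS,
      ⟨S' ∩ Cmp T YS' v, Set.inter_subset_left, ?_, ?_, ?_⟩, ?_⟩
    · rw [hpe] at hfin
      refine hfin.subset ?_
      intro x
      simp only [Set.mem_symmDiff, Set.mem_inter_iff]; tauto
    · rw [hfib]; exact Set.inter_subset_right
    · rw [hfib]
      intro w hw
      exact Cmp_const hS.2 (hsub hvS) hw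
    · intro Φ hΦ
      have hrel : ccRel T G v₀ (XS G v₀ S') (XvY T G v₀ YS' v) :=
        c.rel_of_equiv v₀ hY hS' (c.sf_peri hY hv.1 hfv) hS'nt hfin
      obtain ⟨s, hs4, hsb⟩ := hbig4
      obtain ⟨a, ha, b, hb, d, hd, h1, h2, h3⟩ := Finset.two_lt_card.1 (by omega : 2 < s.card)
      rw [ccOf_eq hrel, hΦ.2.1 YS' v hY hv hfv ⟨a, b, d, hsb ha, hsb hb, hsb hd, h1, h2, h3⟩]
      exact rch_mid ⟨hY, hv⟩
  · have hdis : ∀ e ∈ YS', e ∉ YS := fun e he he' => hYe (cyl_eq_of_mem hYS' hYS he he')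
    obtain ⟨f, hf⟩ := hYS'.1
    obtain ⟨y, hy⟩ : ∃ y, y ∈ f := ⟨_, Sym2.out_fst_mem f⟩
    obtain ⟨η, hη, hyη⟩ := c.cmp_exists hYS y
    have hall : ∀ w ∈ cylVerts YS', w ∈ Cmp T YS η := by
      intro w hw
      obtain ⟨p, hp⟩ := exists_path hT y w
      exact Cmp_trans hyη ⟨p, fun e he => hdis e (c.cyl_convex hYS' ⟨f, hf, hy⟩ hw hp e he)⟩
    have hYout : ∀ z ∈ cylVerts YS, z ∉ S' := by
      intro z hz hzS
      obtain ⟨e, he⟩ := nontriv_cobdry hT hSnt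
      have heY := hS.2 he
      obtain ⟨-, a, b, rfl, -, hb⟩ := he
      exact hb (hsub (c.cyl_const hYS hYS' hYe hS' hz ⟨_, heY, by simp⟩ hzS))
    have hS'sub : S' ⊆ Cmp T YS η := by
      intro w hw
      obtain ⟨ζ, hζ, hwζ⟩ := c.cmp_exists hYS w
      obtain ⟨p, hp⟩ := Cmp_symm hwζ
      obtain ⟨x, d, h1, h2, h3, h4⟩ := walk_cross p hw (hYout ζ hζ)
      have hx1 := Cmp_support p hp (p.fst_mem_support_of_mem_edges h4)
      exact Cmp_trans (hall x ⟨_, hS'.2 (mem_cobdry h1 h2 h3), by simp⟩) (Cmp_symm hx1)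
    obtain ⟨w, hw⟩ : S'.Nonempty := by
      by_contra hc
      rw [Set.not_nonempty_iff_eq_empty] at hc
      exact hS'nt.1 (hc ▸ Set.finite_empty)
    have hηS : η ∈ S := Cmp_const hS.2 (hsub hw) (Cmp_symm (hS'sub hw))
    have hηb : η ∈ cylBoundary T YS :=
      bdry_of_cmp hη (hS'sub hw) (fun h => hYout η hη (h ▸ hw))
    have hfib : {w : V | projIs T (cylVerts YS) w η} = Cmp T YS η := by
      ext w; exact c.proj_iff hYS hη
    refine ⟨η, Or.inl ⟨YS', hYS', hYe, hS', fun w hw => (c.proj_iff hYS hη).2 (hall w hw)⟩, hη, hηS,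
      ⟨S', subset_rfl, by simp, by rw [hfib]; exact hS'sub, ?_⟩, ?_⟩
    · rw [hfib]
      intro w hw
      exact Cmp_const hS.2 hηS hw
    · intro Φ hΦ
      obtain ⟨-, e, he, hηe, heY⟩ := id hηb
      obtain ⟨Z, hZ, heZ⟩ := cyl_exists (G := G) he
      have hZne : Z ≠ YS := fun h => heY (h ▸ heZ)
      have hm : MidOK T G η Z := ⟨hZ, bdry_of_two hZ hYS hZne ⟨e, heZ, hηe⟩ hη⟩
      obtain ⟨p, hp⟩ := hyη
      exact (((rch_mid hm).trans (rch_cyl hZne hm).symm).trans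
        (rch_walk hYS p hp hZ hYS' hZne hYe ⟨e, heZ, hηe⟩ ⟨f, hf, hy⟩)).trans
        (c.phi_rch v₀ hYS' hYe hS' hS'nt hΦ)

end SSRN
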